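/- arXiv:2506.03845 — 8 statements merged into one kernel-verified Lean document; each statement's English description precedes it below -/
import Mathlib

section
/- Let 𝒜 be a complex unital Banach algebra, let n ≥ 1 be an integer, and let a ∈ 𝒜. Then a^n − a^{2n} is quasinilpotent if and only if a − a^{n+1} is quasinilpotent. -/
variable {A : Type*} [NormedRing A] [NormedAlgebra ℂ A] [CompleteSpace A]

/-- An element of a complex unital Banach algebra is quasinilpotent if its spectrum is `{0}`. -/
def IsQuasinilpotent (q : A) : Prop := spectrum ℂ q = {0}

/-- `a` is generalized `n`-strong Drazin invertible (gns-Drazin invertible): there is `x`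
commuting with every element commuting with `a`, with `x * a * x = x` and
`a ^ n - a * x` quasinilpotent. -/
def IsGnsDrazinInvertible (n : ℕ) (a : A) : Prop :=
  ∃ x : A, (∀ y : A, y * a = a * y → x * y = y * x) ∧ x * a * x = x ∧
    IsQuasinilpotent (a ^ n - a * x)

open Polynomial in
theorem isQuasinilpotent_aeval_iff [Nontrivial A] (a : A) (p : ℂ[X]) :
    IsQuasinilpotent (aeval a p) ↔ ∀ k ∈ spectrum ℂ a, p.eval k = 0 := by
  have hne : (spectrum ℂ a).Nonempty := spectrum.nonempty a
  unfold IsQuasinilpotent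
  rw [spectrum.map_polynomial_aeval_of_nonempty a p hne,
    Set.eq_singleton_iff_nonempty_unique_mem]
  constructor
  · rintro ⟨-, h⟩ k hk
    exact h _ ⟨k, hk, rfl⟩
  · intro h
    refine ⟨hne.image _, ?_⟩
    rintro _ ⟨k, hk, rfl⟩
    exact h k hk

theorem quasinilpotent_pow_sub_pow_iff (n : ℕ) (hn : 1 ≤ n) (a : A) :
    IsQuasinilpotent (a ^ n - a ^ (2 * n)) ↔ IsQuasinilpotent (a - a ^ (n + 1)) := by
  rcases subsingleton_or_nontrivial A with hA | hA
  · rw [Subsingleton.elim (a ^ n - a ^ (2 * n)) (a - a ^ (n + 1))]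
  · have h1 := isQuasinilpotent_aeval_iff a
      (Polynomial.X ^ n - Polynomial.X ^ (2 * n) : Polynomial ℂ)
    have h2 := isQuasinilpotent_aeval_iff a
      (Polynomial.X - Polynomial.X ^ (n + 1) : Polynomial ℂ)
    simp only [map_sub, map_pow, Polynomial.aeval_X, Polynomial.eval_sub, Polynomial.eval_pow,
      Polynomial.eval_X] at h1 h2
    rw [h1, h2]
    refine forall₂_congr fun k _ => ?_
    have e1 : k ^ n - k ^ (2 * n) = k ^ n * (1 - k ^ n) := by ring
    have e2 : k - k ^ (n + 1) = k * (1 - k ^ n) := by ring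
    have hn0 : n ≠ 0 := by omega
    rw [e1, e2, mul_eq_zero, mul_eq_zero, pow_eq_zero_iff hn0]
end

section
/- Let 𝒜 be a complex unital Banach algebra, let n ≥ 1 be an integer, and let a ∈ 𝒜. Then a is gns-Drazin invertible if and only if a^n − a^{2n} is quasinilpotent. -/
variable {A : Type*} [NormedRing A] [NormedAlgebra ℂ A] [CompleteSpace A]

open Filter Topology in
lemma qn_summable {K : Type*} [NormedCommRing K] [NormedAlgebra ℂ K] [CompleteSpace K]
    (w : K) (hw : IsQuasinilpotent w) :
    Summable (fun k : ℕ => ‖(catalan k : K) * w ^ k‖) := by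
  have hr : spectralRadius ℂ w = 0 := by
    unfold IsQuasinilpotent at hw
    simp [spectralRadius, hw]
  have h := spectrum.pow_norm_pow_one_div_tendsto_nhds_spectralRadius w
  rw [hr] at h
  have h1 : ∀ᶠ k : ℕ in atTop, ENNReal.ofReal (‖w ^ k‖ ^ (1 / k : ℝ)) < ENNReal.ofReal (1/8) :=
    h.eventually_lt_const (by simp)
  refine Summable.of_norm_bounded_eventually_nat (g := fun k : ℕ => (1/2 : ℝ) ^ k)
    (summable_geometric_of_lt_one (by norm_num) (by norm_num)) ?_
  filter_upwards [h1, eventually_ge_atTop 1] with k hk hk1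
  rw [ENNReal.ofReal_lt_ofReal_iff (by norm_num)] at hk
  have hk0 : (k : ℝ) ≠ 0 := by positivity
  have h2 : ‖w ^ k‖ ≤ (1/8 : ℝ) ^ k := by
    have := pow_le_pow_left₀ (by positivity) hk.le k
    rwa [← Real.rpow_natCast, ← Real.rpow_mul (by positivity), one_div_mul_cancel hk0,
      Real.rpow_one] at this
  have h3 : (catalan k : ℝ) ≤ 4 ^ k := by
    have : catalan k ≤ 4 ^ k := by
      rw [catalan_eq_centralBinom_div]
      exact (Nat.div_le_self _ _).trans (Nat.centralBinom_le_four_pow k)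
    exact_mod_cast this
  rw [norm_norm, ← nsmul_eq_mul]
  calc ‖catalan k • w ^ k‖ ≤ catalan k * ‖w ^ k‖ := by
        simpa using norm_nsmul_le (n := catalan k) (a := w ^ k)
    _ ≤ 4 ^ k * (1/8) ^ k := by gcongr
    _ = (1/2) ^ k := by rw [← mul_pow]; norm_num

lemma qn_exists_sq {K : Type*} [NormedCommRing K] [NormedAlgebra ℂ K] [CompleteSpace K]
    (w : K) (hw : IsQuasinilpotent w) : ∃ c : K, c = 1 + w * (c * c) := by
  have hs := qn_summable w hw
  refine ⟨∑' k : ℕ, (catalan k : K) * w ^ k, ?_⟩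
  rw [tsum_mul_tsum_eq_tsum_sum_antidiagonal_of_summable_norm hs hs]
  rw [hs.of_norm.tsum_eq_zero_add,
    ← (summable_norm_sum_mul_antidiagonal_of_summable_norm hs hs).of_norm.tsum_mul_left]
  · congr 1
    · simp
    · refine tsum_congr fun k => ?_
      rw [catalan_succ', Nat.cast_sum, Finset.sum_mul, Finset.mul_sum]
      refine Finset.sum_congr rfl fun ij hij => ?_
      rw [← Finset.HasAntidiagonal.mem_antidiagonal.mp hij]
      push_cast
      ring

lemma qn_mul {K : Type*} [NormedCommRing K] [NormedAlgebra ℂ K] [CompleteSpace K]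
    (q c : K) (hq : IsQuasinilpotent q) : IsQuasinilpotent (q * c) := by
  unfold IsQuasinilpotent at *
  have key : ∀ f : WeakDual.characterSpace ℂ K, f q = 0 := fun f => by
    have : f q ∈ spectrum ℂ q := WeakDual.CharacterSpace.mem_spectrum_iff_exists.2 ⟨f, rfl⟩
    simpa [hq] using this
  obtain ⟨f, hf⟩ := WeakDual.CharacterSpace.mem_spectrum_iff_exists.1
    (show (0 : ℂ) ∈ spectrum ℂ q by simp [hq])
  ext z
  rw [WeakDual.CharacterSpace.mem_spectrum_iff_exists, Set.mem_singleton_iff]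
  constructor
  · rintro ⟨g, rfl⟩
    simp [key]
  · rintro rfl
    exact ⟨f, by simp [key]⟩

lemma qn_unit {K : Type*} [NormedCommRing K] [NormedAlgebra ℂ K] [CompleteSpace K]
    (q : K) (hq : IsQuasinilpotent q) : ∃ v : K, (1 + q) * v = 1 := by
  have h : (-1 : ℂ) ∉ spectrum ℂ q := by
    unfold IsQuasinilpotent at hq
    simp [hq]
  rw [spectrum.notMem_iff] at h
  obtain ⟨v, hv⟩ := h.exists_right_inv
  refine ⟨-v, ?_⟩
  simp only [map_neg, map_one] at hv
  linear_combination hv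

lemma qn_comm {K : Type*} [NormedCommRing K] [NormedAlgebra ℂ K] [CompleteSpace K]
    (n : ℕ) (hn : 1 ≤ n) (a : K) :
    (∃ x, x * a * x = x ∧ IsQuasinilpotent (a ^ n - a * x)) ↔
      IsQuasinilpotent (a ^ n - a ^ (2 * n)) := by
  constructor
  · rintro ⟨x, hx, hq⟩
    have := qn_mul _ (1 - a ^ n - a * x) hq
    convert this using 1
    linear_combination (-a) * hx
  · intro hw
    obtain ⟨c, hc⟩ := qn_exists_sq _ hw
    obtain ⟨y, hy⟩ : ∃ y, y = (a ^ n - a ^ (2 * n)) * c := ⟨_, rfl⟩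
    have hyq : IsQuasinilpotent y := hy ▸ qn_mul _ c hw
    have hyy : y - y * y = a ^ n - a ^ n * a ^ n := by
      rw [← pow_add, ← two_mul, hy]
      linear_combination (a ^ n - a ^ (2 * n)) * hc
    obtain ⟨v, hv⟩ := qn_unit _ (qn_mul y (-2) hyq)
    have he : (a ^ n - y) * v * ((a ^ n - y) * v) = (a ^ n - y) * v := by
      linear_combination ((a ^ n - y) * v) * hv + (v * v) * hyy
    obtain ⟨e, hee⟩ : ∃ e, e = (a ^ n - y) * v := ⟨_, rfl⟩
    rw [← hee] at he
    have hd : a ^ n - e = y * (v * (1 - 2 * a ^ n)) := by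
      rw [hee]; linear_combination (-a ^ n) * hv
    have hdq : IsQuasinilpotent (a ^ n - e) := hd ▸ qn_mul _ _ hyq
    obtain ⟨u, hu⟩ := qn_unit _ hdq
    have hp : a * a ^ (n - 1) = a ^ n := by
      rw [← pow_succ', Nat.sub_add_cancel hn]
    have hax : a * (a ^ (n - 1) * e * u) = e := by
      linear_combination (e * u) * hp + e * hu + u * he
    refine ⟨a ^ (n - 1) * e * u, ?_, by rwa [hax]⟩
    rw [mul_assoc, hax]
    linear_combination (a ^ (n - 1) * u) * he

section
variable {R : Type*} [NormedRing R] [NormedAlgebra ℂ R] [CompleteSpace R]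

/-- The bicommutant of an element. -/
abbrev bicomm (a : R) : Subalgebra ℂ R :=
  Subalgebra.centralizer ℂ (Set.centralizer {a})

lemma mem_bicomm (a x : R) : x ∈ bicomm a ↔ ∀ y : R, y * a = a * y → x * y = y * x := by
  simp only [bicomm, Subalgebra.mem_centralizer_iff, Set.mem_centralizer_iff,
    Set.mem_singleton_iff, forall_eq]
  exact ⟨fun h y hy => (h y hy.symm).symm, fun h y hy => (h y hy.symm).symm⟩

lemma self_mem_bicomm (a : R) : a ∈ bicomm a := (mem_bicomm a a).2 fun _ h => h.symm

lemma bicomm_mul_comm (a : R) (x y : bicomm a) : x * y = y * x := by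
  ext
  have hy := (mem_bicomm a _).1 y.2 a rfl
  exact (mem_bicomm a _).1 x.2 y hy

instance bicommNormedCommRing (a : R) : NormedCommRing (bicomm a) :=
  { (inferInstance : NormedRing (bicomm a)) with mul_comm := bicomm_mul_comm a }

instance bicommComplete (a : R) : CompleteSpace (bicomm a) :=
  (Set.isClosed_centralizer (Set.centralizer {a})).completeSpace_coe

lemma bicomm_isUnit (a : R) (x : bicomm a) : IsUnit x ↔ IsUnit (x : R) := by
  constructor
  · exact fun h => h.map (bicomm a).val
  · rintro ⟨u, hu⟩
    have hm : (↑u⁻¹ : R) ∈ bicomm a := (mem_bicomm a _).2 fun y hy => by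
      have := (mem_bicomm a _).1 x.2 y hy
      rw [← hu] at this
      exact (show Commute (u : R) y from this).units_inv_left.eq
    exact IsUnit.of_mul_eq_one ⟨_, hm⟩ (by ext; simp [← hu])

lemma bicomm_qn (a : R) (x : bicomm a) :
    IsQuasinilpotent x ↔ IsQuasinilpotent (x : R) := by
  unfold IsQuasinilpotent
  have : spectrum ℂ x = spectrum ℂ (x : R) := by
    ext z
    rw [spectrum.mem_iff, spectrum.mem_iff, bicomm_isUnit]
    rfl
  rw [this]

end

theorem isGnsDrazinInvertible_iff_quasinilpotent_pow (n : ℕ) (hn : 1 ≤ n) (a : A) :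
    IsGnsDrazinInvertible n a ↔ IsQuasinilpotent (a ^ n - a ^ (2 * n)) := by
  have h := qn_comm n hn (⟨a, self_mem_bicomm a⟩ : bicomm a)
  rw [show IsQuasinilpotent (a ^ n - a ^ (2 * n)) ↔ _ from
    (bicomm_qn a (⟨a, self_mem_bicomm a⟩ ^ n - ⟨a, self_mem_bicomm a⟩ ^ (2 * n))).symm]
  refine Iff.trans ?_ h
  constructor
  · rintro ⟨x, hx, hxx, hq⟩
    refine ⟨⟨x, (mem_bicomm a x).2 hx⟩, Subtype.ext hxx, ?_⟩
    exact (bicomm_qn a _).2 hq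
  · rintro ⟨x, hxx, hq⟩
    exact ⟨x, (mem_bicomm a x).1 x.2, congrArg Subtype.val hxx, (bicomm_qn a _).1 hq⟩
end

section
/- Let 𝒜 be a complex unital Banach algebra, let n ≥ 1 be an integer, and let a ∈ 𝒜. Then a is gns-Drazin invertible if and only if a − a^{n+1} is quasinilpotent. -/
variable {A : Type*} [NormedRing A] [NormedAlgebra ℂ A] [CompleteSpace A]

open WeakDual Filter Topology in
theorem gns_char_quasi {R : Type*} [NormedCommRing R] [NormedAlgebra ℂ R] [CompleteSpace R]
    [Nontrivial R] (q : R) :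
    spectrum ℂ q = {0} ↔ ∀ φ : characterSpace ℂ R, φ q = 0 := by
  constructor
  · intro h φ
    have : φ q ∈ spectrum ℂ q := CharacterSpace.mem_spectrum_iff_exists.2 ⟨φ, rfl⟩
    rw [h] at this
    simpa using this
  · intro h
    obtain ⟨z, hz⟩ := spectrum.nonempty q
    have key : ∀ w ∈ spectrum ℂ q, w = 0 := by
      intro w hw
      obtain ⟨φ, hφ⟩ := CharacterSpace.mem_spectrum_iff_exists.1 hw
      rw [← hφ, h]
    ext w
    simp only [Set.mem_singleton_iff]
    refine ⟨key w, ?_⟩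
    rintro rfl
    rw [← key z hz]; exact hz

open WeakDual in
theorem gns_char_unit {R : Type*} [NormedCommRing R] [NormedAlgebra ℂ R] [CompleteSpace R]
    (u : R) (h : ∀ φ : characterSpace ℂ R, φ u ≠ 0) : IsUnit u := by
  rw [← spectrum.zero_notMem_iff ℂ]
  intro h0
  obtain ⟨φ, hφ⟩ := CharacterSpace.mem_spectrum_iff_exists.1 h0
  exact h φ hφ

open Filter Topology in
theorem gns_summable {R : Type*} [NormedCommRing R] [NormedAlgebra ℂ R] [CompleteSpace R]
    (c : R) (hc : spectrum ℂ c = {0}) : Summable fun k => ‖(catalan k : R) * c ^ k‖ := by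
  have hr : spectralRadius ℂ c = 0 := by
    simp [spectralRadius, hc]
  have ht := spectrum.pow_norm_pow_one_div_tendsto_nhds_spectralRadius c
  rw [hr] at ht
  have hev : ∀ᶠ k : ℕ in atTop, ‖(catalan k : R) * c ^ k‖ ≤ (1/2 : ℝ) ^ k := by
    have h8 : (0 : ENNReal) < ENNReal.ofReal (1/8) := by simp
    filter_upwards [ht.eventually_lt_const h8, eventually_gt_atTop 0] with k hk hk0
    have h1 : ‖c ^ k‖ ^ (1 / k : ℝ) < 1/8 := by
      rwa [ENNReal.ofReal_lt_ofReal_iff (by norm_num)] at hk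
    have h2 : ‖c ^ k‖ ≤ (1/8 : ℝ) ^ k := by
      have := pow_le_pow_left₀ (by positivity) h1.le k
      rwa [one_div, Real.rpow_inv_natCast_pow (norm_nonneg _) hk0.ne'] at this
    have h3 : (catalan k : ℝ) ≤ 4 ^ k := by
      have : catalan k ≤ 4 ^ k := by
        calc catalan k ≤ (k + 1) * catalan k := Nat.le_mul_of_pos_left _ (by omega)
          _ = k.centralBinom := succ_mul_catalan_eq_centralBinom k
          _ ≤ 4 ^ k := Nat.centralBinom_le_four_pow k
      exact_mod_cast this
    rw [← nsmul_eq_mul]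
    calc ‖catalan k • c ^ k‖ ≤ catalan k * ‖c ^ k‖ := by
          simpa using norm_nsmul_le (n := catalan k) (a := c ^ k)
      _ ≤ 4 ^ k * (1/8) ^ k := by gcongr
      _ = (1/2) ^ k := by rw [← mul_pow]; norm_num
  have hg : Summable fun k : ℕ => (1/2 : ℝ) ^ k := summable_geometric_two
  refine summable_of_isBigO_nat hg (Asymptotics.IsBigO.of_bound 1 ?_)
  filter_upwards [hev] with k hk
  simpa using hk

theorem gns_catalan {R : Type*} [NormedCommRing R] [NormedAlgebra ℂ R] [CompleteSpace R]
    (c : R) (hc : spectrum ℂ c = {0}) : ∃ S : R, S = 1 + c * S ^ 2 := by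
  have hs := gns_summable c hc
  refine ⟨∑' k, (catalan k : R) * c ^ k, ?_⟩
  rw [pow_two, tsum_mul_tsum_eq_tsum_sum_antidiagonal_of_summable_norm hs hs,
    ← Summable.tsum_mul_left _ (summable_norm_sum_mul_antidiagonal_of_summable_norm hs hs).of_norm,
    hs.of_norm.tsum_eq_zero_add]
  simp only [catalan_zero, Nat.cast_one, pow_zero, mul_one]
  congr 1
  refine tsum_congr fun k => ?_
  rw [catalan_succ', Nat.cast_sum, Finset.sum_mul, Finset.mul_sum]
  refine Finset.sum_congr rfl fun ij hij => ?_
  rw [← Finset.HasAntidiagonal.mem_antidiagonal.1 hij]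
  push_cast
  ring

open WeakDual in
theorem gns_comm {R : Type*} [NormedCommRing R] [NormedAlgebra ℂ R] [CompleteSpace R]
    (n : ℕ) (hn : 1 ≤ n) (a : R) :
    (∃ x : R, x * a * x = x ∧ spectrum ℂ (a ^ n - a * x) = {0}) ↔
      spectrum ℂ (a - a ^ (n + 1)) = {0} := by
  rcases subsingleton_or_nontrivial R with hR | hR
  · have : ∀ q : R, spectrum ℂ q ≠ {0} := fun q h => by
      rw [spectrum.of_subsingleton] at h
      exact Set.singleton_ne_empty _ h.symm
    simp [this]
  simp only [gns_char_quasi, map_sub, map_mul, map_pow]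
  constructor
  · rintro ⟨x, hx, h⟩ φ
    have hx' := congrArg φ hx
    simp only [map_mul] at hx'
    have := h φ
    by_cases h0 : φ x = 0
    · rw [h0, mul_zero, sub_zero] at this
      have ha := eq_zero_of_pow_eq_zero this
      simp [ha]
    · have h1 : φ x * φ a = 1 := mul_right_cancel₀ h0 (by rw [hx', one_mul])
      linear_combination (-(φ a)) * this - (φ a) * h1
  · intro h
    have hc : spectrum ℂ (a ^ n - (a ^ n) ^ 2) = {0} := by
      rw [gns_char_quasi]
      intro φ
      obtain ⟨m, rfl⟩ : ∃ m, n = m + 1 := ⟨n - 1, by omega⟩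
      simp only [map_sub, map_pow]
      linear_combination (φ a) ^ m * h φ
    obtain ⟨S, hS⟩ := gns_catalan _ hc
    rw [gns_char_quasi] at hc
    set b := a ^ n with hb
    have hd : IsUnit (1 - 2 * (b - b ^ 2) * S) := by
      apply gns_char_unit
      intro φ
      have := hc φ
      simp [this]
    obtain ⟨i, hi⟩ := hd.exists_right_inv
    obtain ⟨t, ht⟩ : ∃ t : R, 2 * t = 1 := by
      refine ⟨algebraMap ℂ R (1/2), ?_⟩
      rw [← map_ofNat (algebraMap ℂ R) 2, ← map_mul]
      norm_num
    obtain ⟨e, he⟩ : ∃ e : R, e = t * (1 - (1 - 2 * b) * i) := ⟨_, rfl⟩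
    have hsq : ((1 - 2 * b) * i) ^ 2 = 1 := by
      have h1 : (1 - 2 * (b - b ^ 2) * S) ^ 2 = (1 - 2 * b) ^ 2 := by
        linear_combination (-4 * (b - b ^ 2)) * hS
      rw [mul_pow, ← h1, ← mul_pow, hi, one_pow]
    have hee : e * e = e := by
      rw [he]
      linear_combination t ^ 2 * hsq + t * (1 - (1 - 2 * b) * i) * ht
    have hφe : ∀ φ : characterSpace ℂ R, φ e = φ a ^ n := by
      intro φ
      have h1 := congrArg φ hi
      have h2 := congrArg φ ht
      have h3 := hc φ
      rw [he]
      simp only [map_mul, map_sub, map_one, map_ofNat, map_pow] at h1 h2 h3 ⊢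
      rw [h3] at h1
      have h4 : φ i = 1 := by linear_combination h1
      rw [h4, hb, map_pow]
      linear_combination (φ a) ^ n * h2
    have hu : IsUnit (a + 1 - e) := by
      apply gns_char_unit
      intro φ
      simp only [map_add, map_sub, map_one, hφe]
      intro h0
      have h1 := h φ
      by_cases ha : φ a = 0
      · rw [ha, zero_pow (by omega)] at h0
        simp at h0
      · have : φ a ^ n = 1 := by
          apply mul_left_cancel₀ ha
          linear_combination -h1
        rw [this] at h0
        apply ha
        linear_combination h0
    obtain ⟨j, hj⟩ := hu.exists_right_inv
    have hax : a * (e * j) = e := by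
      linear_combination e * hj + j * hee
    refine ⟨e * j, ?_, ?_⟩
    · linear_combination (e * j) * hax + j * hee
    · intro φ
      have := congrArg φ hax
      simp only [map_mul] at this
      rw [map_mul, this, hφe, sub_self]

theorem isGnsDrazinInvertible_iff_quasinilpotent (n : ℕ) (hn : 1 ≤ n) (a : A) :
    IsGnsDrazinInvertible n a ↔ IsQuasinilpotent (a - a ^ (n + 1)) := by
  let B : Subalgebra ℂ A :=
    Subalgebra.centralizer ℂ (Subalgebra.centralizer ℂ ({a} : Set A) : Set A)
  have hmem : ∀ x : A, x ∈ B ↔ ∀ y : A, y * a = a * y → x * y = y * x := by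
    intro x
    simp only [B, Subalgebra.mem_centralizer_iff, SetLike.mem_coe, Set.mem_singleton_iff,
      forall_eq]
    exact ⟨fun h y hy => (h y hy.symm).symm, fun h y hy => (h y hy.symm).symm⟩
  have haB : a ∈ B := (hmem a).2 fun y hy => hy.symm
  have hcomm : ∀ x y : B, x * y = y * x := by
    intro x y
    apply Subtype.ext
    have hy : (y : A) * a = a * y := (hmem y).1 y.2 a rfl
    exact (hmem x).1 x.2 y hy
  have hclosed : IsClosed (B : Set A) := Set.isClosed_centralizer _
  haveI : CompleteSpace B := hclosed.completeSpace_coe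
  letI : NormedCommRing B := { (inferInstance : NormedRing B) with mul_comm := hcomm }
  have hunit : ∀ x : B, IsUnit x ↔ IsUnit (x : A) := by
    intro x
    refine ⟨fun h => h.map B.val, ?_⟩
    rintro ⟨u, hu⟩
    have hinv : (↑u⁻¹ : A) ∈ B := by
      rw [hmem]
      intro y hy
      have h1 : Commute (u : A) y := by rw [hu]; exact (hmem x).1 x.2 y hy
      exact h1.units_inv_left
    refine IsUnit.of_mul_eq_one (⟨_, hinv⟩ : B) ?_
    apply Subtype.ext
    change (x : A) * ↑u⁻¹ = 1
    rw [← hu, Units.mul_inv]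
  have hspec : ∀ x : B, spectrum ℂ x = spectrum ℂ (x : A) := by
    intro x
    ext z
    rw [spectrum.mem_iff, spectrum.mem_iff, hunit]
    rfl
  have main := gns_comm n hn (⟨a, haB⟩ : B)
  unfold IsGnsDrazinInvertible IsQuasinilpotent
  have e1 := hspec (⟨a, haB⟩ - ⟨a, haB⟩ ^ (n + 1))
  refine Iff.trans ?_ (main.trans (by rw [e1]; rfl))
  constructor
  · rintro ⟨x, hx, h1, h2⟩
    refine ⟨⟨x, (hmem x).2 hx⟩, Subtype.ext h1, ?_⟩
    rw [hspec]; exact h2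
  · rintro ⟨x, h1, h2⟩
    refine ⟨x, (hmem x).1 x.2, congrArg Subtype.val h1, ?_⟩
    rw [hspec] at h2; exact h2
end

section
/- Let 𝒜 be a complex unital Banach algebra, let n ≥ 1 be an integer, and let a, b ∈ 𝒜 both be gns-Drazin invertible. If a² b = a b a, then a b is gns-Drazin invertible. -/
variable {A : Type*} [NormedRing A] [NormedAlgebra ℂ A] [CompleteSpace A]

set_option linter.unusedSectionVars false

/-- Growth version of quasinilpotency. -/
def QNil (q : A) : Prop := ∀ ε : ℝ, 0 < ε → ∃ C : ℝ, 0 ≤ C ∧ ∀ k : ℕ, ‖q ^ k‖ ≤ C * ε ^ k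

theorem norm_pow_le_const (y : A) : ∃ M : ℝ, 0 ≤ M ∧ ∀ k : ℕ, ‖y ^ k‖ ≤ M * ‖y‖ ^ k := by
  refine ⟨max 1 ‖(1 : A)‖, by positivity, fun k => ?_⟩
  rcases Nat.eq_zero_or_pos k with rfl | hk
  · simp
  · calc ‖y ^ k‖ ≤ 1 * ‖y‖ ^ k := by rw [one_mul]; exact norm_pow_le' y hk
      _ ≤ _ := by gcongr; exact le_max_left _ _

theorem QNil.of_bound {q r : A} (hq : QNil q) (M L : ℝ) (hM : 0 ≤ M) (hL : 0 ≤ L)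
    (h : ∀ k, ‖r ^ k‖ ≤ M * L ^ k * ‖q ^ k‖) : QNil r := by
  intro ε hε
  obtain ⟨C, hC, h1⟩ := hq (ε / (L + 1)) (by positivity)
  refine ⟨M * C, by positivity, fun k => (h k).trans ?_⟩
  calc M * L ^ k * ‖q ^ k‖ ≤ M * (L + 1) ^ k * (C * (ε / (L + 1)) ^ k) := by
        gcongr
        · linarith
        · exact h1 k
    _ = M * C * ((L + 1) * (ε / (L + 1))) ^ k := by rw [mul_pow]; ring
    _ = _ := by rw [mul_div_cancel₀]; positivity

theorem QNil.mul_right {q y : A} (hq : QNil q) (h : Commute q y) : QNil (q * y) := by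
  obtain ⟨M, hM, hy⟩ := norm_pow_le_const y
  refine hq.of_bound M ‖y‖ hM (norm_nonneg _) fun k => ?_
  rw [h.mul_pow]
  calc _ ≤ ‖q ^ k‖ * ‖y ^ k‖ := norm_mul_le _ _
    _ ≤ ‖q ^ k‖ * (M * ‖y‖ ^ k) := by gcongr; exact hy k
    _ = _ := by ring

theorem QNil.mul_left {q y : A} (hq : QNil q) (h : Commute q y) : QNil (y * q) := by
  rw [← h.eq]; exact hq.mul_right h

theorem QNil.neg {q : A} (hq : QNil q) : QNil (-q) := by
  have := hq.mul_right (Commute.neg_one_right q)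
  simpa using this

theorem QNil.add {q r : A} (hq : QNil q) (hr : QNil r) (h : Commute q r) : QNil (q + r) := by
  intro ε hε
  obtain ⟨C, hC, h1⟩ := hq (ε / 2) (by positivity)
  obtain ⟨D, hD, h2⟩ := hr (ε / 2) (by positivity)
  refine ⟨C * D, by positivity, fun k => ?_⟩
  rw [h.add_pow]
  calc _ ≤ ∑ m ∈ Finset.range (k + 1), ‖q ^ m * r ^ (k - m) * (k.choose m : A)‖ :=
        norm_sum_le _ _
    _ ≤ ∑ m ∈ Finset.range (k + 1), (C * D * ((ε / 2) ^ m * (ε / 2) ^ (k - m) * k.choose m)) := by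
        refine Finset.sum_le_sum fun m _ => ?_
        rw [← Nat.cast_commute (k.choose m), ← nsmul_eq_mul]
        calc _ ≤ (k.choose m : ℝ) * ‖q ^ m * r ^ (k - m)‖ := norm_nsmul_le
          _ ≤ (k.choose m : ℝ) * ((C * (ε / 2) ^ m) * (D * (ε / 2) ^ (k - m))) := by
              gcongr
              refine (norm_mul_le _ _).trans ?_
              gcongr
              · exact h1 m
              · exact h2 _
          _ = _ := by ring
    _ = C * D * ε ^ k := by
        rw [← Finset.mul_sum, ← add_pow, add_halves]

theorem QNil.spec_zero {q : A} (hq : QNil q) {z : ℂ} (hz : z ∈ spectrum ℂ q) : z = 0 := by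
  by_contra h0
  have hpos : 0 < ‖z‖ := norm_pos_iff.mpr h0
  obtain ⟨C, hC, h1⟩ := hq (‖z‖ / 2) (by positivity)
  have key : ∀ k : ℕ, (2 : ℝ) ^ k ≤ C * ‖(1 : A)‖ := by
    intro k
    have h2 := spectrum.norm_le_norm_mul_of_mem (spectrum.pow_mem_pow q k hz)
    rw [norm_pow] at h2
    have h3 : ‖z‖ ^ k ≤ C * (‖z‖ / 2) ^ k * ‖(1 : A)‖ :=
      h2.trans (by gcongr; exact h1 k)
    rw [div_pow] at h3
    have h4 : 0 < ‖z‖ ^ k := by positivity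
    have h5 : ‖z‖ ^ k * 2 ^ k ≤ ‖z‖ ^ k * (C * ‖(1 : A)‖) := by
      calc ‖z‖ ^ k * 2 ^ k ≤ (C * (‖z‖ ^ k / 2 ^ k) * ‖(1 : A)‖) * 2 ^ k := by gcongr
        _ = _ := by field_simp
    exact le_of_mul_le_mul_left h5 h4
  obtain ⟨k, hk⟩ := pow_unbounded_of_one_lt (C * ‖(1 : A)‖) (one_lt_two : (1 : ℝ) < 2)
  exact absurd (key k) (not_le.mpr hk)

theorem qnil_of_spec {q : A} (h : ∀ z ∈ spectrum ℂ q, z = 0) : QNil q := by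
  intro ε hε
  have hr : spectralRadius ℂ q = 0 := by
    simp only [spectralRadius, ENNReal.iSup_eq_zero]
    intro z hz
    simp [h z hz]
  have ht := spectrum.pow_norm_pow_one_div_tendsto_nhds_spectralRadius q
  rw [hr] at ht
  have hev := ht.eventually (gt_mem_nhds (ENNReal.ofReal_pos.mpr hε))
  obtain ⟨N, hN⟩ := Filter.eventually_atTop.mp hev
  refine ⟨1 + ∑ i ∈ Finset.range (N + 1), ‖q ^ i‖ / ε ^ i, by positivity, fun k => ?_⟩
  have hs : 0 ≤ ∑ i ∈ Finset.range (N + 1), ‖q ^ i‖ / ε ^ i :=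
    Finset.sum_nonneg fun i _ => by positivity
  by_cases hk : k < N + 1
  · have h1 : ‖q ^ k‖ / ε ^ k ≤ ∑ i ∈ Finset.range (N + 1), ‖q ^ i‖ / ε ^ i :=
      Finset.single_le_sum (f := fun i => ‖q ^ i‖ / ε ^ i) (fun i _ => by positivity)
        (Finset.mem_range.mpr hk)
    rw [← div_le_iff₀ (by positivity)]
    linarith
  · have hk0 : k ≠ 0 := by omega
    have h1 := hN k (by omega)
    have h2 : ‖q ^ k‖ ^ (1 / k : ℝ) < ε := (ENNReal.ofReal_lt_ofReal_iff hε).mp h1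
    have h3 : ‖q ^ k‖ ≤ ε ^ k := by
      have h4 : (‖q ^ k‖ ^ (1 / k : ℝ)) ^ k ≤ ε ^ k := by gcongr
      rwa [one_div, Real.rpow_inv_natCast_pow (norm_nonneg _) hk0] at h4
    have : 0 < ε ^ k := by positivity
    nlinarith

theorem isQuasinilpotent_iff [Nontrivial A] (q : A) : IsQuasinilpotent q ↔ QNil q := by
  constructor
  · intro h
    exact qnil_of_spec fun z hz => by rw [h] at hz; simpa using hz
  · intro h
    obtain ⟨z, hz⟩ := spectrum.nonempty q
    have := h.spec_zero hz
    ext w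
    constructor
    · intro hw; exact h.spec_zero hw
    · intro hw
      rw [Set.mem_singleton_iff] at hw
      rw [hw, ← this]; exact hz

theorem QNil.of_pow {q : A} {n : ℕ} (h : QNil (q ^ n)) : QNil q :=
  qnil_of_spec fun _ hz => eq_zero_of_pow_eq_zero (h.spec_zero (spectrum.pow_mem_pow q n hz))

theorem QNil.isUnit_one_add {q : A} (h : QNil q) : IsUnit (1 + q) := by
  by_contra hu
  have : (-1 : ℂ) ∈ spectrum ℂ q := by
    rw [spectrum.mem_iff]
    intro h2
    apply hu
    have := h2.neg
    simpa [add_comm] using this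
  have := h.spec_zero this
  norm_num at this

theorem catalan_le (k : ℕ) : (catalan k : ℝ) ≤ 4 ^ k := by
  have h1 := succ_mul_catalan_eq_centralBinom k
  have h2 := Nat.centralBinom_le_four_pow k
  have : catalan k ≤ 4 ^ k := by nlinarith [Nat.zero_le (k * catalan k)]
  exact_mod_cast this

/-- Solve `z - z² = v` for `v` quasinilpotent. -/
theorem exists_quad {v : A} (hv : QNil v) :
    ∃ z : A, QNil z ∧ z - z * z = v ∧ ∀ y, Commute y v → Commute y z := by
  obtain ⟨C, hC, h1⟩ := hv (1 / 8) (by norm_num)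
  set f : ℕ → A := fun k => catalan k • v ^ k with hf
  have hfs : Summable fun k => ‖f k‖ := by
    refine Summable.of_nonneg_of_le (fun _ => norm_nonneg _) (g := fun k => ‖f k‖)
      (f := fun k => C * (1 / 2 : ℝ) ^ k) (fun k => ?_)
      ((summable_geometric_of_lt_one (by norm_num) (by norm_num)).mul_left C)
    calc ‖f k‖ ≤ catalan k * ‖v ^ k‖ := norm_nsmul_le
      _ ≤ 4 ^ k * (C * (1 / 8) ^ k) := by
          gcongr
          · exact catalan_le k
          · exact h1 k
      _ = C * (4 * (1 / 8)) ^ k := by rw [mul_pow]; ring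
      _ = _ := by norm_num
  have hsum : Summable f := hfs.of_norm
  set c := ∑' k, f k with hc
  have hcomm : ∀ y, Commute y v → Commute y c := by
    intro y hy
    rw [hc, Commute, SemiconjBy, ← hsum.tsum_mul_left, ← hsum.tsum_mul_right]
    exact tsum_congr fun k => ((hy.pow_right k).smul_right _).eq
  have hcv : Commute v c := hcomm v (Commute.refl v)
  have hsq : c = 1 + v * (c * c) := by
    rw [hc, tsum_mul_tsum_eq_tsum_sum_antidiagonal_of_summable_norm hfs hfs]
    have : ∀ k, ∑ kl ∈ Finset.HasAntidiagonal.antidiagonal k, f kl.1 * f kl.2 = catalan (k + 1) • v ^ k := by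
      intro k
      rw [catalan_succ', Finset.sum_smul]
      refine Finset.sum_congr rfl fun x hx => ?_
      rw [← Finset.HasAntidiagonal.mem_antidiagonal.mp hx]
      simp only [hf]
      rw [smul_mul_smul_comm, pow_add]
    simp_rw [this]
    have h2 : Summable fun k => catalan (k + 1) • v ^ k := by
      have := (summable_norm_sum_mul_antidiagonal_of_summable_norm hfs hfs).of_norm
      simpa only [‹∀ k, ∑ kl ∈ Finset.HasAntidiagonal.antidiagonal k, f kl.1 * f kl.2 = _›] using this
    rw [← h2.tsum_mul_left, hsum.tsum_eq_zero_add]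
    congr 1
    · simp [hf]
    · refine tsum_congr fun k => ?_
      simp only [hf]
      rw [mul_smul_comm, pow_succ']
  refine ⟨v * c, hv.mul_right hcv, ?_, fun y hy => hy.mul_right (hcomm y hy)⟩
  calc v * c - v * c * (v * c) = v * c - v * (v * (c * c)) := by
        rw [mul_assoc v c, ← mul_assoc c v c, ← hcv.eq, mul_assoc v c c]
    _ = v * (c - v * (c * c)) := by rw [mul_sub]
    _ = v := by nth_rewrite 1 [hsq]; simp

/-- Inverses of elements commuting with `y` commute with `y`. -/
theorem exists_inv_commute {w : A} (h : IsUnit w) :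
    ∃ s : A, w * s = 1 ∧ s * w = 1 ∧ ∀ y, Commute y w → Commute y s := by
  obtain ⟨u, rfl⟩ := h
  exact ⟨(u⁻¹ : Aˣ), by simp, by simp, fun y hy => hy.units_inv_right⟩

/-- Lifting idempotents modulo quasinilpotents. -/
theorem exists_idem_lift {p : A} (hp : QNil (p - p * p)) :
    ∃ e : A, e * e = e ∧ QNil (p - e) ∧ ∀ y, Commute y p → Commute y e := by
  set w := p - p * p with hw
  have hwc : ∀ y, Commute y p → Commute y w := fun y hy => hy.sub_right (hy.mul_right hy)
  have h4 : Commute w (-4 : A) := by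
    have := (Nat.cast_commute 4 w).symm.neg_right
    simpa using this
  have h4y : ∀ y : A, Commute y (-4 : A) := by
    intro y
    have := (Nat.cast_commute 4 y).symm.neg_right
    simpa using this
  obtain ⟨s, hs1, hs2, hs⟩ := exists_inv_commute (hp.mul_right h4).isUnit_one_add
  have hsc : ∀ y, Commute y p → Commute y s := fun y hy =>
    hs y ((Commute.one_right y).add_right ((hwc y hy).mul_right (h4y y)))
  have hpp := Commute.refl p
  have hps := hsc p hpp
  have hws : Commute w s := hsc w (hwc p hpp).symm
  obtain ⟨z, hz1, hz2, hz3⟩ := exists_quad (hp.mul_right hws).neg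
  have hzc : ∀ y, Commute y p → Commute y z := fun y hy =>
    hz3 y ((hwc y hy).mul_right (hsc y hy)).neg_right
  have hpz : Commute p z := hzc p hpp
  have h2y : ∀ y : A, Commute y (2 : A) := fun y => by
    have := (Nat.cast_commute 2 y).symm
    simpa using this
  refine ⟨p + (1 - 2 * p) * z, ?_, ?_, fun y hy => ?_⟩
  · have e1 : (p + (1 - 2 * p) * z) * (p + (1 - 2 * p) * z) - (p + (1 - 2 * p) * z)
        = -w - (1 + w * (-4)) * (z - z * z) := by
      have h : z * p = p * z := hpz.eq.symm
      have h' : ∀ t, z * (p * t) = p * (z * t) := fun t => by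
        rw [← mul_assoc, h, mul_assoc]
      rw [hw]
      have e2 : (2 : A) = 1 + 1 := by norm_num
      have e4 : (4 : A) = 1 + 1 + 1 + 1 := by norm_num
      rw [e2, e4]
      simp only [mul_add, add_mul, mul_sub, sub_mul, mul_assoc, h, h', mul_one, one_mul, mul_neg, neg_mul]
      abel
    have e3 : (1 + w * (-4)) * (z - z * z) = -w := by
      rw [hz2, mul_neg, hws.eq, ← mul_assoc, hs1, one_mul]
    rw [e3, sub_self] at e1
    exact sub_eq_zero.mp e1
  · have : p - (p + (1 - 2 * p) * z) = -((1 - 2 * p) * z) := by abel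
    rw [this]
    exact (hz1.mul_left ((Commute.one_right z).sub_right
      ((h2y z).mul_right hpz.symm))).neg
  · exact hy.add_right (((Commute.one_right y).sub_right ((h2y y).mul_right hy)).mul_right
      (hzc y hy))

theorem gns_of_qnil [Nontrivial A] {n : ℕ} (hn : 1 ≤ n) {u : A} (hu : QNil (u - u ^ (n + 1))) :
    IsGnsDrazinInvertible n u := by
  obtain ⟨m, rfl⟩ : ∃ m, n = m + 1 := ⟨n - 1, by omega⟩
  have huu := Commute.refl u
  have hp : QNil (u ^ (m + 1) - u ^ (m + 1) * u ^ (m + 1)) := by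
    have := hu.mul_left (y := u ^ m)
      ((huu.pow_right m).sub_left (huu.pow_pow _ _))
    convert this using 1
    rw [mul_sub, ← pow_succ, ← pow_add, ← pow_add]
    congr 2
    omega
  obtain ⟨e, he, hq, hec⟩ := exists_idem_lift hp
  set q := u ^ (m + 1) - e with hqd
  have hec' : ∀ y, Commute y u → Commute y e := fun y hy => hec y (hy.pow_right _)
  have hqc : ∀ y, Commute y u → Commute y q := fun y hy => (hy.pow_right _).sub_right (hec' y hy)
  have heu : Commute e u := (hec' u huu).symm
  have hqe : Commute q e := (hqc e heu).symm
  obtain ⟨s, hs1, hs2, hs⟩ := exists_inv_commute (hq.mul_right hqe).isUnit_one_add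
  have hsc : ∀ y, Commute y u → Commute y s := fun y hy =>
    hs y ((Commute.one_right y).add_right ((hqc y hy).mul_right (hec' y hy)))
  have hux : u * (u ^ m * (e * s)) = e := by
    rw [← mul_assoc, ← pow_succ', ← mul_assoc]
    have : u ^ (m + 1) * e = e * (1 + q * e) := by
      have h1 : u ^ (m + 1) = e + q := by rw [hqd]; abel
      rw [h1, add_mul, mul_add, mul_one, hqe.eq, ← mul_assoc, he]
    rw [this, mul_assoc, hs1, mul_one]
  have hxc : ∀ y, Commute y u → Commute y (u ^ m * (e * s)) := fun y hy =>
    (hy.pow_right m).mul_right ((hec' y hy).mul_right (hsc y hy))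
  refine ⟨u ^ m * (e * s), fun y hy => (hxc y hy).eq.symm, ?_, ?_⟩
  · rw [mul_assoc, hux, ← (hxc e heu).eq, ← mul_assoc, ← (heu.pow_right m).symm.eq, mul_assoc,
      ← mul_assoc e e, he]
  · rw [hux, isQuasinilpotent_iff]
    exact hq

theorem qnil_of_gns [Nontrivial A] {n : ℕ} (hn : 1 ≤ n) {a : A} (h : IsGnsDrazinInvertible n a) :
    QNil (a - a ^ (n + 1)) := by
  obtain ⟨x, hx, hxax, hq⟩ := h
  rw [isQuasinilpotent_iff] at hq
  have hxa : Commute x a := hx a rfl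
  have hae : Commute a (a * x) := (Commute.refl a).mul_right hxa.symm
  set e := a * x with he
  have hee : e * e = e := by
    rw [he, mul_assoc, ← mul_assoc x, hxax]
  set q := a ^ n - e with hqd
  have hqa : Commute q a := ((Commute.refl a).pow_left n).sub_left hae.symm
  have hqe : Commute q e := (hae.pow_left n).sub_left (Commute.refl e)
  have hidem : IsIdempotentElem (1 - e) := IsIdempotentElem.one_sub hee
  have han : a ^ n = e + q := by rw [hqd]; abel
  have h1 : QNil (a * (1 - e)) := by
    apply QNil.of_pow (n := n)
    rw [((Commute.one_right a).sub_right hae).mul_pow, hidem.pow_eq (by omega)]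
    have : a ^ n * (1 - e) = q * (1 - e) := by
      rw [han, add_mul, mul_sub e, hee, mul_one, sub_self, zero_add]
    rw [this]
    exact hq.mul_right ((Commute.one_right q).sub_right hqe)
  have h2 : QNil (a * q) := hq.mul_left hqa
  have hc : Commute (a * (1 - e)) (a * q) := by
    have c1 : Commute a (a * q) := (Commute.refl a).mul_right hqa.symm
    have c2 : Commute e (a * q) := hae.symm.mul_right hqe.symm
    exact c1.mul_left ((Commute.one_left _).sub_left c2)
  have := h1.add h2.neg hc.neg_right
  convert this using 1
  rw [pow_succ', han, mul_sub, mul_add, mul_one]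
  abel

theorem isGnsDrazinInvertible_mul (n : ℕ) (hn : 1 ≤ n) (a b : A)
    (ha : IsGnsDrazinInvertible n a) (hb : IsGnsDrazinInvertible n b)
    (hab : a ^ 2 * b = a * b * a) :
    IsGnsDrazinInvertible n (a * b) := by
  have hnt : Nontrivial A := by
    by_contra hA
    rw [not_nontrivial_iff_subsingleton] at hA
    obtain ⟨x, -, -, hq⟩ := ha
    rw [IsQuasinilpotent, spectrum.of_subsingleton] at hq
    exact absurd hq.symm (Set.singleton_ne_empty 0)
  have hfa := qnil_of_gns hn ha
  have hfb := qnil_of_gns hn hb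
  apply gns_of_qnil hn
  have hau : Commute a (a * b) := by
    rw [Commute, SemiconjBy, ← hab, pow_two, mul_assoc]
  have hpow : ∀ k : ℕ, (a * b) ^ k = a ^ k * b ^ k := by
    intro k
    induction k with
    | zero => simp
    | succ k ih =>
      rw [pow_succ, ← mul_assoc, ← (hau.pow_right k).eq, ih, pow_succ', pow_succ, mul_assoc,
        mul_assoc, mul_assoc]
  set f := a - a ^ (n + 1) with hf
  set g := b - b ^ (n + 1) with hg
  set c := a ^ (n + 1) * g with hc
  -- `f * b` in terms of `a` and `a * b`
  have hfb' : f * b = (1 - a ^ n) * (a * b) := by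
    rw [hf, ← mul_assoc, sub_mul 1, one_mul, ← pow_succ]
  have hc' : c = a ^ n * (a * b) - (a * b) ^ (n + 1) := by
    rw [hc, hg, hpow, mul_sub, pow_succ a, mul_assoc (a ^ n) a b]
  have hac : Commute a c := by
    rw [hc']
    exact (((Commute.refl a).pow_right n).mul_right hau).sub_right (hau.pow_right _)
  have huc : Commute (a * b) c := by
    rw [hc']
    exact ((hau.symm.pow_right n).mul_right (Commute.refl _)).sub_right
      ((Commute.refl _).pow_right _)
  have hafb : Commute a (f * b) := by
    rw [hfb']
    exact ((Commute.one_right a).sub_right ((Commute.refl a).pow_right n)).mul_right hau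
  have hffb : Commute f (f * b) := hafb.sub_left (hafb.pow_left _)
  have hcomm : Commute (f * b) c := by
    rw [hfb']
    exact ((Commute.one_left c).sub_left (hac.pow_left n)).mul_left huc
  have h1 : QNil (f * b) := by
    have hp1 : ∀ k : ℕ, (f * b) ^ k = f ^ k * b ^ k := by
      intro k
      induction k with
      | zero => simp
      | succ k ih =>
        rw [pow_succ, ← mul_assoc, ← (hffb.pow_right k).eq, ih, pow_succ', pow_succ, mul_assoc,
          mul_assoc, mul_assoc]
    obtain ⟨M, hM, hy⟩ := norm_pow_le_const b
    refine hfa.of_bound M ‖b‖ hM (norm_nonneg _) fun k => ?_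
    rw [hp1]
    calc _ ≤ ‖f ^ k‖ * ‖b ^ k‖ := norm_mul_le _ _
      _ ≤ ‖f ^ k‖ * (M * ‖b‖ ^ k) := by gcongr; exact hy k
      _ = _ := by ring
  have h2 : QNil c := by
    have hp2 : ∀ k : ℕ, c ^ k = (a ^ (n + 1)) ^ k * g ^ k := by
      intro k
      induction k with
      | zero => simp
      | succ k ih =>
        rw [pow_succ', ih, ← mul_assoc, ← ((hac.pow_left (n + 1)).pow_left k).eq, pow_succ (a ^ (n + 1)) k,
          pow_succ' g, hc]
        simp only [mul_assoc]
    obtain ⟨M, hM, hy⟩ := norm_pow_le_const (a ^ (n + 1))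
    refine hfb.of_bound M ‖a ^ (n + 1)‖ hM (norm_nonneg _) fun k => ?_
    rw [hp2]
    calc _ ≤ ‖(a ^ (n + 1)) ^ k‖ * ‖g ^ k‖ := norm_mul_le _ _
      _ ≤ _ := by gcongr; exact hy k
  have := h1.add h2 hcomm
  convert this using 1
  rw [hfb', hc', sub_mul, one_mul]
  abel
end

section
/- Let 𝒜 be a complex unital Banach algebra, let n ≥ 1 be an integer, and let a, b ∈ 𝒜 both be gns-Drazin invertible. If a b = 0, then a + b is gns-Drazin invertible. -/
variable {A : Type*} [NormedRing A] [NormedAlgebra ℂ A] [CompleteSpace A]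

lemma gns_qn_iff [Nontrivial A] (q : A) :
    IsQuasinilpotent q ↔ ∀ z ∈ spectrum ℂ q, z = 0 := by
  unfold IsQuasinilpotent
  rw [Set.eq_singleton_iff_nonempty_unique_mem]
  exact ⟨fun h => h.2, fun h => ⟨spectrum.nonempty q, h⟩⟩

lemma gns_qn_radius [Nontrivial A] (q : A) :
    IsQuasinilpotent q ↔ spectralRadius ℂ q = 0 := by
  rw [gns_qn_iff]
  unfold spectralRadius
  simp

lemma gns_qn_mul [Nontrivial A] {q y : A} (hq : IsQuasinilpotent q) (h : Commute q y) :
    IsQuasinilpotent (q * y) := by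
  rw [gns_qn_radius] at *
  have h1 := spectrum.pow_nnnorm_pow_one_div_tendsto_nhds_spectralRadius (q * y)
  have h2 := spectrum.pow_nnnorm_pow_one_div_tendsto_nhds_spectralRadius q
  rw [hq] at h2
  have h3 := ENNReal.Tendsto.mul_const (b := (‖y‖₊ : ENNReal)) h2 (Or.inr ENNReal.coe_ne_top)
  rw [zero_mul] at h3
  refine le_antisymm (le_of_tendsto_of_tendsto h1 h3 ?_) bot_le
  filter_upwards [Filter.eventually_ge_atTop 1] with k hk
  have hk0 : (k : ℝ) ≠ 0 := by positivity
  have : (‖y‖₊ : ENNReal) = ((‖y‖₊ : ENNReal) ^ k) ^ (1 / k : ℝ) := by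
    rw [← ENNReal.rpow_natCast, ← ENNReal.rpow_mul, mul_one_div_cancel hk0, ENNReal.rpow_one]
  rw [this, ← ENNReal.mul_rpow_of_nonneg _ _ (by positivity)]
  apply ENNReal.rpow_le_rpow _ (by positivity)
  rw [h.mul_pow]
  norm_cast
  exact (nnnorm_mul_le _ _).trans (by gcongr; exact nnnorm_pow_le' y hk)

lemma gns_summable_s5 [Nontrivial A] {w : A} (hw : IsQuasinilpotent w) :
    Summable (fun k => ‖(catalan k) • w ^ k‖) := by
  rw [gns_qn_radius] at hw
  have h2 := spectrum.pow_nnnorm_pow_one_div_tendsto_nhds_spectralRadius w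
  rw [hw] at h2
  have h8 : (0 : ENNReal) < ((1 / 8 : NNReal) : ENNReal) := by
    rw [ENNReal.coe_pos]; norm_num
  have h3 := h2.eventually (gt_mem_nhds h8)
  have hs : Summable (fun k : ℕ => (1 / 2 : ℝ) ^ k) := summable_geometric_two
  refine Summable.of_norm_bounded_eventually_nat hs ?_
  filter_upwards [h3, Filter.eventually_ge_atTop 1] with k hk hk1
  have hk0 : (k : ℝ) ≠ 0 := by positivity
  have h4 : (‖w ^ k‖₊ : ENNReal) ≤ ((1 / 8 : NNReal) : ENNReal) ^ k := by
    have := ENNReal.rpow_le_rpow hk.le (show (0 : ℝ) ≤ k by positivity)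
    rwa [← ENNReal.rpow_mul, one_div_mul_cancel hk0, ENNReal.rpow_one, ENNReal.rpow_natCast] at this
  have h5 : ‖w ^ k‖ ≤ (1 / 8 : ℝ) ^ k := by
    have h6 : ‖w ^ k‖₊ ≤ (1 / 8 : NNReal) ^ k := by exact_mod_cast h4
    have h7 : ((‖w ^ k‖₊ : NNReal) : ℝ) ≤ (((1 / 8 : NNReal) ^ k : NNReal) : ℝ) :=
      NNReal.coe_le_coe.2 h6
    simpa using h7
  have h6 : catalan k ≤ 4 ^ k := by
    rw [catalan_eq_centralBinom_div]
    refine (Nat.div_le_self _ _).trans ?_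
    rw [Nat.centralBinom, show (4 : ℕ) = 2 ^ 2 by norm_num, ← pow_mul]
    exact Nat.choose_le_two_pow _ _
  have h7 : (catalan k : ℝ) ≤ 4 ^ k := by exact_mod_cast h6
  rw [norm_norm]
  calc ‖catalan k • w ^ k‖ ≤ catalan k * ‖w ^ k‖ := norm_nsmul_le
    _ ≤ 4 ^ k * (1 / 8) ^ k := by gcongr
    _ = (1 / 2) ^ k := by rw [← mul_pow]; norm_num

/-- The Catalan generating function at a quasinilpotent element. -/
lemma gns_catalan_s5 [Nontrivial A] {w : A} (hw : IsQuasinilpotent w) :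
    ∃ c : A, (∀ y : A, Commute y w → Commute y c) ∧ c = 1 + w * (c * c) := by
  have hs := gns_summable_s5 hw
  refine ⟨∑' k, catalan k • w ^ k, fun y hy => ?_, ?_⟩
  · refine Commute.tsum_right y fun k => ?_
    exact (hy.pow_right k).smul_right _
  · rw [tsum_mul_tsum_eq_tsum_sum_antidiagonal_of_summable_norm hs hs,
      ← hs.of_norm.sum_add_tsum_nat_add 1,
      ← (summable_norm_sum_mul_antidiagonal_of_summable_norm hs hs).of_norm.tsum_mul_left w]
    · simp only [Finset.range_one, Finset.sum_singleton, catalan_zero, pow_zero, one_smul]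
      congr 1
      refine tsum_congr fun k => ?_
      rw [catalan_succ', Finset.sum_smul, Finset.mul_sum]
      refine Finset.sum_congr rfl fun x hx => ?_
      rw [Finset.HasAntidiagonal.mem_antidiagonal] at hx
      rw [smul_mul_smul_comm, ← pow_add, hx, mul_smul_comm, ← pow_succ']

/-- Lifting of idempotents modulo quasinilpotents. -/
lemma gns_lift [Nontrivial A] {e : A} (hw : IsQuasinilpotent (e - e * e)) :
    ∃ p : A, (∀ y : A, Commute y e → Commute y p) ∧ p * p = p ∧ IsQuasinilpotent (e - p) := by
  obtain ⟨c, hc, hcc⟩ := gns_catalan_s5 hw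
  set w := e - e * e with hwdef
  have hcom : ∀ y : A, Commute y e → Commute y w := fun y hy => hy.sub_right (hy.mul_right hy)
  have hew : Commute e w := hcom e (Commute.refl e)
  have hec : Commute e c := hc e hew
  have hwc : Commute w c := hc w (Commute.refl w)
  have hq : IsQuasinilpotent (w * (2 * c)) :=
    gns_qn_mul hw ((Nat.cast_commute 2 w).symm.mul_right hwc)
  have hu : IsUnit (1 - w * (2 * c)) := by
    by_contra hcon
    have : (1 : ℂ) ∈ spectrum ℂ (w * (2 * c)) := by
      rw [spectrum.mem_iff, map_one]; exact hcon
    exact one_ne_zero ((gns_qn_iff _).1 hq 1 this)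
  obtain ⟨s, hs⟩ := hu
  have hys : ∀ y : A, Commute y e → Commute y (↑s⁻¹ : A) := by
    intro y hy
    refine Commute.units_inv_right ?_
    rw [hs]
    exact (Commute.one_right y).sub_right ((hcom y hy).mul_right
      ((Nat.cast_commute 2 y).symm.mul_right (hc y (hcom y hy))))
  have hes := hys e (Commute.refl e)
  have hss : (s : A) * s = (1 - 2 * e) * (1 - 2 * e) := by
    have h1 : w * (w * (c * c)) = w * c - w := by
      have := congrArg (w * ·) hcc
      simp only [mul_add, mul_one] at this
      rw [eq_sub_iff_add_eq, add_comm]; exact this.symm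
    have h2 : (w * c) * (w * c) = w * c - w := by
      rw [← h1, mul_assoc, ← mul_assoc c, ← hwc.eq, mul_assoc w c c]
    have h3 : (s : A) = 1 - 2 * (w * c) := by
      rw [hs]; noncomm_ring
    have h4 : (s : A) * s = 1 - 4 * (w * c) + 4 * ((w * c) * (w * c)) := by
      rw [h3]; noncomm_ring
    rw [h4, h2, hwdef]; noncomm_ring
  set t : A := (↑s⁻¹ : A) with ht
  have hts : t * s = 1 := s.inv_mul
  have hst : (s : A) * t = 1 := s.mul_inv
  have hft : Commute (1 - 2 * e) t :=
    (Commute.one_left t).sub_left ((Nat.cast_commute 2 t).mul_left hes)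
  have hg : (t * (1 - 2 * e)) * (t * (1 - 2 * e)) = 1 := by
    calc (t * (1 - 2 * e)) * (t * (1 - 2 * e)) = t * (((1 - 2 * e) * t) * (1 - 2 * e)) := by
          simp only [mul_assoc]
      _ = t * (t * ((1 - 2 * e) * (1 - 2 * e))) := by rw [hft.eq]; simp only [mul_assoc]
      _ = t * ((t * s) * s) := by rw [← hss]; simp only [mul_assoc]
      _ = 1 := by rw [hts, one_mul, hts]
  set g := t * (1 - 2 * e) with hgdef
  refine ⟨(1 / 2 : ℂ) • (1 - g), fun y hy => ?_, ?_, ?_⟩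
  · refine Commute.smul_right ?_ _
    refine (Commute.one_right y).sub_right ((hys y hy).mul_right ?_)
    exact (Commute.one_right y).sub_right ((Nat.cast_commute 2 y).symm.mul_right hy)
  · rw [smul_mul_smul_comm]
    have : (1 - g) * (1 - g) = (2 : ℂ) • (1 - g) := by
      rw [mul_sub, sub_mul, sub_mul, hg, two_smul]; noncomm_ring
    rw [this, smul_smul]; norm_num
  · have key : e - (1 / 2 : ℂ) • (1 - g) = w * ((c * t) * (1 - 2 * e)) := by
      have h1 : (2 : ℂ) • (e - (1 / 2 : ℂ) • (1 - g)) = g - (1 - 2 * e) := by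
        rw [smul_sub, smul_smul, two_smul]; norm_num; noncomm_ring
      have h2 : g - (1 - 2 * e) = (1 - s) * (t * (1 - 2 * e)) := by
        rw [sub_mul, one_mul, ← mul_assoc (s : A), hst, one_mul]
      have h3 : (1 - (s : A)) * (t * (1 - 2 * e)) = (2 : ℂ) • (w * ((c * t) * (1 - 2 * e))) := by
        rw [hs, two_smul]; noncomm_ring
      rw [h2, h3] at h1
      exact smul_right_injective A (two_ne_zero : (2 : ℂ) ≠ 0) h1
    rw [key]
    refine gns_qn_mul hw ((hwc.mul_right (hys w hew.symm)).mul_right ?_)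
    exact (Commute.one_right w).sub_right ((Nat.cast_commute 2 w).symm.mul_right hew.symm)

lemma gns_spec [Nontrivial A] (n : ℕ) (a : A) :
    IsQuasinilpotent (a ^ n - a ^ n * a ^ n) ↔ ∀ z ∈ spectrum ℂ a, z ^ n - z ^ n * z ^ n = 0 := by
  have h := spectrum.map_polynomial_aeval a
    (Polynomial.X ^ n - Polynomial.X ^ n * Polynomial.X ^ n : Polynomial ℂ)
  simp only [map_sub, map_mul, map_pow, Polynomial.aeval_X, Polynomial.eval_sub,
    Polynomial.eval_mul, Polynomial.eval_pow, Polynomial.eval_X] at h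
  rw [gns_qn_iff, h]
  simp

lemma gns_iff [Nontrivial A] (n : ℕ) (hn : 1 ≤ n) (a : A) :
    IsGnsDrazinInvertible n a ↔ IsQuasinilpotent (a ^ n - a ^ n * a ^ n) := by
  constructor
  · rintro ⟨x, hx, hxx, hq⟩
    have hxa : Commute x a := hx a rfl
    have hp : (a * x) * (a * x) = a * x := by
      rw [mul_assoc, ← mul_assoc x, hxx]
    have hpa : Commute (a ^ n) (a * x) :=
      ((Commute.refl a).mul_right hxa.symm).pow_left n
    generalize a ^ n = e at *
    generalize a * x = p at *
    have : e - e * e = (e - p) * (1 - p - e) := by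
      have := hpa.eq
      rw [mul_sub, mul_sub, sub_mul, sub_mul, hp, this, mul_one]; noncomm_ring
    rw [this]
    refine gns_qn_mul hq ?_
    have h1 : Commute (e - p) p := hpa.sub_left (Commute.refl p)
    have h2 : Commute (e - p) e := (Commute.refl e).sub_left hpa.symm
    exact ((Commute.one_right _).sub_right h1).sub_right h2
  · intro h
    obtain ⟨p, hp, hpp, hq⟩ := gns_lift h
    have hu : IsUnit (a ^ n + 1 - p) := by
      by_contra hcon
      have : (-1 : ℂ) ∈ spectrum ℂ (a ^ n - p) := by
        rw [spectrum.mem_iff, map_neg, map_one]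
        intro h
        apply hcon
        have := h.neg
        convert this using 1
        abel
      have := (gns_qn_iff _).1 hq _ this
      norm_num at this
    obtain ⟨u, hu⟩ := hu
    have hyu : ∀ y : A, Commute y a → Commute y (↑u⁻¹ : A) := by
      intro y hy
      refine Commute.units_inv_right ?_
      rw [hu]
      exact ((hy.pow_right n).add_right (Commute.one_right y)).sub_right (hp y (hy.pow_right n))
    have hyp : ∀ y : A, Commute y a → Commute y p := fun y hy => hp y (hy.pow_right n)
    have hpu : Commute p (↑u⁻¹ : A) := hyu p (hyp a (Commute.refl a)).symm
    have hup : (u : A) * p = a ^ n * p := by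
      rw [hu, sub_mul, add_mul, hpp, one_mul]; abel
    have hax : a * (a ^ (n - 1) * (↑u⁻¹ * p)) = p := by
      rw [← mul_assoc, ← pow_succ', Nat.sub_add_cancel hn, ← hpu.eq, ← mul_assoc, ← hup,
        mul_assoc, hpu.eq, ← mul_assoc, u.mul_inv, one_mul]
    refine ⟨a ^ (n - 1) * (↑u⁻¹ * p), fun y hy => ?_, ?_, ?_⟩
    · have hy : Commute y a := hy
      exact ((hy.pow_right _).mul_right ((hyu y hy).mul_right (hyp y hy))).symm.eq
    · rw [mul_assoc, hax, mul_assoc, mul_assoc, hpp]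
    · rw [hax]; exact hq

theorem isGnsDrazinInvertible_add_of_mul_eq_zero (n : ℕ) (hn : 1 ≤ n) (a b : A)
    (ha : IsGnsDrazinInvertible n a) (hb : IsGnsDrazinInvertible n b)
    (hab : a * b = 0) :
    IsGnsDrazinInvertible n (a + b) := by
  have hnt : Nontrivial A := by
    by_contra hcon
    rw [not_nontrivial_iff_subsingleton] at hcon
    obtain ⟨x, -, -, hq⟩ := ha
    unfold IsQuasinilpotent at hq
    rw [spectrum.of_subsingleton] at hq
    exact (Set.singleton_nonempty (0 : ℂ)).ne_empty hq.symm
  rw [gns_iff n hn, gns_spec] at *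
  intro z hz
  by_cases hz0 : z = 0
  · subst hz0
    simp [show n ≠ 0 by omega]
  by_cases hza : z ∈ spectrum ℂ a
  · exact ha z hza
  by_cases hzb : z ∈ spectrum ℂ b
  · exact hb z hzb
  exfalso
  rw [spectrum.mem_iff] at hz
  rw [spectrum.notMem_iff] at hza hzb
  apply hz
  have h := hza.mul hzb
  have h2 : (algebraMap ℂ A z - a) * (algebraMap ℂ A z - b)
      = algebraMap ℂ A z * (algebraMap ℂ A z - (a + b)) := by
    rw [mul_sub, sub_mul, sub_mul, hab, mul_sub, mul_add, (Algebra.commutes z a)]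
    abel
  rw [h2] at h
  have h3 : IsUnit (algebraMap ℂ A z) := (IsUnit.mk0 z hz0).map (algebraMap ℂ A)
  obtain ⟨v, hv⟩ := h3
  rw [← hv, Units.isUnit_units_mul] at h
  rwa [hv] at h
end

section
/- Let 𝒜 be a complex unital Banach algebra, let n ≥ 1 be an integer, let a ∈ 𝒜 be quasinilpotent, and let b ∈ 𝒜 be gns-Drazin invertible with gns-Drazin inverse y; set b^π = 1 − b y. If a = a b^π and b^π b a = b^π a b, then a + b is gns-Drazin invertible. -/
variable {A : Type*} [NormedRing A] [NormedAlgebra ℂ A] [CompleteSpace A]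

theorem qn_iff [Nontrivial A] (q : A) :
    IsQuasinilpotent q ↔ ∀ l : ℂ, l ≠ 0 → IsUnit (algebraMap ℂ A l - q) := by
  unfold IsQuasinilpotent
  constructor
  · intro h l hl
    by_contra hc
    have : l ∈ spectrum ℂ q := hc
    rw [h] at this
    exact hl this
  · intro h
    apply (spectrum.nonempty q).subset_singleton_iff.1
    intro l hl
    by_contra hc
    exact hl (h l hc)

theorem qn_growth (q : A) (h : IsQuasinilpotent q) (ε : ℝ) (hε : 0 < ε) :
    ∃ M : ℝ, 0 < M ∧ ∀ k : ℕ, ‖q ^ k‖ ≤ M * ε ^ k := by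
  have hr : spectralRadius ℂ q = 0 := by
    unfold IsQuasinilpotent at h
    simp [spectralRadius, h]
  have ht := spectrum.pow_norm_pow_one_div_tendsto_nhds_spectralRadius q
  rw [hr] at ht
  have hev := ht.eventually (gt_mem_nhds (ENNReal.ofReal_pos.2 hε))
  obtain ⟨N, hN⟩ := Filter.eventually_atTop.1 hev
  refine ⟨1 + ∑ k ∈ Finset.range (N + 1), ‖q ^ k‖ / ε ^ k, by positivity, fun k => ?_⟩
  have hk : 0 < ε ^ k := pow_pos hε k
  rw [← div_le_iff₀ hk]
  by_cases hkN : k < N + 1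
  · have := Finset.single_le_sum (f := fun k => ‖q ^ k‖ / ε ^ k)
      (fun i _ => by positivity) (Finset.mem_range.2 hkN)
    linarith
  · have h1 := hN k (by omega)
    have h2 : ‖q ^ k‖ ^ (1 / k : ℝ) < ε := (ENNReal.ofReal_lt_ofReal_iff hε).1 h1
    have h3 : ‖q ^ k‖ ≤ ε ^ k := by
      have h4 : (‖q ^ k‖ ^ (1 / k : ℝ)) ^ k ≤ ε ^ k :=
        pow_le_pow_left₀ (by positivity) h2.le k
      rwa [one_div, Real.rpow_inv_natCast_pow (norm_nonneg _) (by omega)] at h4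
    have h5 : ‖q ^ k‖ / ε ^ k ≤ 1 := (div_le_one hk).2 h3
    have : 0 ≤ ∑ k ∈ Finset.range (N + 1), ‖q ^ k‖ / ε ^ k := by positivity
    linarith

theorem qn_of_growth [Nontrivial A] (q : A)
    (h : ∀ ε : ℝ, 0 < ε → ∃ M : ℝ, 0 < M ∧ ∀ k : ℕ, ‖q ^ k‖ ≤ M * ε ^ k) :
    IsQuasinilpotent q := by
  unfold IsQuasinilpotent
  apply (spectrum.nonempty q).subset_singleton_iff.1
  intro l hl
  by_contra hc
  have hc : l ≠ 0 := hc
  have hl0 : 0 < ‖l‖ := norm_pos_iff.2 hc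
  obtain ⟨M, hM, hk⟩ := h (‖l‖ / 2) (by positivity)
  have hb : ∀ k : ℕ, (2 : ℝ) ^ k ≤ M * ‖(1 : A)‖ := by
    intro k
    have h1 : l ^ k ∈ spectrum ℂ (q ^ k) := spectrum.pow_mem_pow q k hl
    have h2 := spectrum.norm_le_norm_mul_of_mem h1
    rw [norm_pow] at h2
    have h3 : ‖l‖ ^ k ≤ M * (‖l‖ / 2) ^ k * ‖(1 : A)‖ :=
      h2.trans (mul_le_mul_of_nonneg_right (hk k) (norm_nonneg _))
    rw [div_pow] at h3
    have h4 : 0 < ‖l‖ ^ k := by positivity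
    have h5 : (0:ℝ) < 2 ^ k := by positivity
    have h6 : M * (‖l‖ ^ k / 2 ^ k) * ‖(1 : A)‖ = (M * ‖(1:A)‖ / 2 ^ k) * ‖l‖ ^ k := by ring
    rw [h6] at h3
    have h7 : 1 ≤ M * ‖(1:A)‖ / 2 ^ k := by
      by_contra hh
      push Not at hh
      nlinarith
    rwa [one_le_div h5] at h7
  obtain ⟨k, hk'⟩ := pow_unbounded_of_one_lt (M * ‖(1 : A)‖) (one_lt_two : (1:ℝ) < 2)
  exact absurd (hb k) (not_le.2 hk')

theorem norm_pow_le_aux (w : A) (k : ℕ) : ‖w ^ k‖ ≤ (‖(1 : A)‖ + 1) * (‖w‖ + 1) ^ k := by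
  rcases Nat.eq_zero_or_pos k with rfl | hk
  · simp
  · have h1 := norm_pow_le' w hk
    have h2 : ‖w‖ ^ k ≤ (‖w‖ + 1) ^ k := pow_le_pow_left₀ (norm_nonneg _) (by linarith) k
    have h3 : 0 ≤ ‖(1 : A)‖ * (‖w‖ + 1) ^ k := by positivity
    linarith

theorem qn_mul_s7 [Nontrivial A] (w q : A) (hc : Commute w q) (h : IsQuasinilpotent q) :
    IsQuasinilpotent (w * q) := by
  apply qn_of_growth
  intro ε hε
  obtain ⟨M, hM, hk⟩ := qn_growth q h (ε / (‖w‖ + 1)) (by positivity)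
  refine ⟨(‖(1 : A)‖ + 1) * M, by positivity, fun k => ?_⟩
  rw [hc.mul_pow]
  calc ‖w ^ k * q ^ k‖ ≤ ‖w ^ k‖ * ‖q ^ k‖ := norm_mul_le _ _
    _ ≤ ((‖(1 : A)‖ + 1) * (‖w‖ + 1) ^ k) * (M * (ε / (‖w‖ + 1)) ^ k) :=
      mul_le_mul (norm_pow_le_aux w k) (hk k) (norm_nonneg _) (by positivity)
    _ = (‖(1 : A)‖ + 1) * M * ε ^ k := by
      rw [div_pow]
      have : (‖w‖ + 1) ^ k ≠ 0 := by positivity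
      field_simp

theorem qn_add [Nontrivial A] (u v : A) (hc : Commute u v) (hu : IsQuasinilpotent u)
    (hv : IsQuasinilpotent v) : IsQuasinilpotent (u + v) := by
  apply qn_of_growth
  intro ε hε
  obtain ⟨M, hM, hk⟩ := qn_growth u hu (ε / 2) (by positivity)
  obtain ⟨M', hM', hk'⟩ := qn_growth v hv (ε / 2) (by positivity)
  refine ⟨M * M', by positivity, fun k => ?_⟩
  rw [hc.add_pow]
  calc _ ≤ ∑ m ∈ Finset.range (k + 1), ‖u ^ m * v ^ (k - m) * (k.choose m : A)‖ :=
        norm_sum_le _ _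
    _ ≤ ∑ m ∈ Finset.range (k + 1), (M * M') * ((ε/2) ^ m * (ε/2) ^ (k - m) * (k.choose m : ℝ)) := by
        apply Finset.sum_le_sum
        intro m _
        rw [mul_comm' , ← nsmul_eq_mul]
        have h1 : ‖u ^ m * v ^ (k - m)‖ ≤ (M * (ε/2)^m) * (M' * (ε/2)^(k-m)) :=
          (norm_mul_le _ _).trans (mul_le_mul (hk _) (hk' _) (norm_nonneg _) (by positivity))
        calc _ ≤ (k.choose m : ℝ) * ‖u ^ m * v ^ (k - m)‖ := norm_nsmul_le
          _ ≤ (k.choose m : ℝ) * ((M * (ε/2)^m) * (M' * (ε/2)^(k-m))) := by gcongr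
          _ = _ := by ring
    _ = M * M' * ε ^ k := by
        rw [← Finset.mul_sum, ← add_pow, add_halves]
where mul_comm' {x : A} {j : ℕ} : x * (j : A) = (j : A) * x := (Nat.cast_commute j x).eq.symm

theorem qn_of_pow [Nontrivial A] (q : A) (n : ℕ) (h : IsQuasinilpotent (q ^ n)) :
    IsQuasinilpotent q := by
  unfold IsQuasinilpotent at *
  apply (spectrum.nonempty q).subset_singleton_iff.1
  intro l hl
  have := spectrum.pow_mem_pow q n hl
  rw [h] at this
  exact eq_zero_of_pow_eq_zero this

theorem qn_pow [Nontrivial A] (q : A) (n : ℕ) (hn : 1 ≤ n) (h : IsQuasinilpotent q) :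
    IsQuasinilpotent (q ^ n) := by
  obtain ⟨m, rfl⟩ := Nat.exists_eq_add_of_le' hn
  rw [pow_succ]
  exact qn_mul_s7 _ _ (Commute.pow_left (Commute.refl q) m) h

theorem qn_swap [Nontrivial A] (u v : A) (h : IsQuasinilpotent (u * v)) :
    IsQuasinilpotent (v * u) := by
  unfold IsQuasinilpotent at *
  apply (spectrum.nonempty _).subset_singleton_iff.1
  intro l hl
  by_contra hc
  have h1 : l ∈ spectrum ℂ (v * u) \ {0} := ⟨hl, hc⟩
  rw [spectrum.nonzero_mul_comm, h] at h1
  exact h1.2 h1.1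

/-- Block upper triangular elements with quasinilpotent diagonal. -/
theorem qn_block [Nontrivial A] (p t : A) (hp : p * p = p) (h0 : (1 - p) * t * p = 0)
    (h1 : IsQuasinilpotent (p * t * p)) (h2 : IsQuasinilpotent ((1 - p) * t * (1 - p))) :
    IsQuasinilpotent t := by
  rw [qn_iff] at *
  intro l hl
  obtain ⟨u, hu⟩ := h1 l hl
  obtain ⟨v, hv⟩ := h2 l hl
  have hl' : IsUnit (algebraMap ℂ A l) := (IsUnit.mk0 l hl).map (algebraMap ℂ A)
  obtain ⟨w, hw⟩ := hl'
  have hpe : p * (1 - p) = 0 := by rw [mul_sub, hp, mul_one, sub_self]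
  have hep : (1 - p) * p = 0 := by rw [sub_mul, hp, one_mul, sub_self]
  set L := algebraMap ℂ A l with hL
  have hLc : ∀ z, L * z = z * L := fun z => Algebra.commutes l z
  set e := 1 - p with he
  have hee : e * e = e := by rw [he]; rw [mul_sub, ← he, hep]; simp
  set s := p * t * p + e * t * e with hs
  have hts : t = s + p * t * e := by
    have : t = (p + e) * t * (p + e) := by simp [he]
    rw [hs]
    conv_lhs => rw [this]
    simp only [add_mul, mul_add, h0]; abel
  -- the diagonal part
  have hprod : L * (L - s) = (L - p * t * p) * (L - e * t * e) := by
    have : p * t * p * (e * t * e) = 0 := by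
      calc _ = p * t * (p * e) * (t * e) := by noncomm_ring
        _ = 0 := by rw [hpe]; simp
    rw [sub_mul L, mul_sub L L, mul_sub (p * t * p) L, this, ← hLc (p * t * p), mul_sub, hs, mul_add]
    abel
  have hsu : IsUnit (L - s) := by
    have : L - s = ↑(w⁻¹ * (u * v)) := by
      push_cast
      rw [hu, hv, ← hprod, ← hw, Units.inv_mul_cancel_left]
    rw [this]; exact Units.isUnit _
  obtain ⟨r, hr⟩ := hsu
  have hcp : Commute p (r : A) := by
    rw [hr]
    have h3 : p * s = s * p := by
      rw [hs, mul_add, add_mul]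
      have a1 : p * (p * t * p) = p * t * p := by rw [← mul_assoc, ← mul_assoc, hp]
      have a2 : p * t * p * p = p * t * p := by rw [mul_assoc, hp]
      have a3 : p * (e * t * e) = 0 := by rw [← mul_assoc, ← mul_assoc, hpe]; simp
      have a4 : e * t * e * p = 0 := by rw [mul_assoc, hep]; simp
      rw [a1, a2, a3, a4]
    show p * (L - s) = (L - s) * p
    rw [mul_sub, sub_mul, h3, hLc]
  have hcp' : p * (↑r⁻¹ : A) = ↑r⁻¹ * p := hcp.units_inv_right.eq
  have hnil : IsNilpotent ((↑r⁻¹ : A) * (p * t * e)) := by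
    refine ⟨2, ?_⟩
    rw [pow_two]
    calc _ = ↑r⁻¹ * (p * t * e) * ((↑r⁻¹ * p) * t * e) := by simp only [mul_assoc]
      _ = ↑r⁻¹ * (p * t) * (e * p) * (↑r⁻¹ * t * e) := by rw [← hcp']; simp only [mul_assoc]
      _ = 0 := by rw [hep]; simp
  have hfin : L - t = r * (1 - ↑r⁻¹ * (p * t * e)) := by
    rw [mul_sub, Units.mul_inv_cancel_left, hr, mul_one]
    conv_lhs => rw [hts]
    abel
  rw [hfin]
  exact r.isUnit.mul hnil.isUnit_one_sub

theorem norm_zero_of_bound (z : A) (C : ℝ) (h : ∀ k : ℕ, ‖z‖ ≤ C * (1 / 2) ^ k) : z = 0 := by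
  have ht : Filter.Tendsto (fun k : ℕ => C * (1 / 2 : ℝ) ^ k) Filter.atTop (nhds (C * 0)) :=
    (tendsto_pow_atTop_nhds_zero_of_lt_one (by norm_num) (by norm_num)).const_mul C
  rw [mul_zero] at ht
  have := ge_of_tendsto' ht h
  exact norm_le_zero_iff.1 this

theorem bicomm_s7 [Nontrivial A] (n : ℕ) (hn : 1 ≤ n) (d x : A) (hc : d * x = x * d)
    (hx : x * d * x = x)
    (hq : IsQuasinilpotent (d ^ n - d * x)) : ∀ z : A, z * d = d * z → x * z = z * x := by
  have hcd : Commute d x := hc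
  set p := d * x with hp
  have hpp : p * p = p := by rw [hp]; rw [mul_assoc, ← mul_assoc x, hx]
  have hdp : Commute d p := (Commute.refl d).mul_right hcd
  have hpe : (1 - p) * p = 0 := by rw [sub_mul, hpp, one_mul, sub_self]
  have hee : (1 - p) * (1 - p) = 1 - p := by rw [mul_sub, hpe]; simp
  have hde : Commute d (1 - p) := (Commute.one_right d).sub_right hdp
  have hqe : IsQuasinilpotent (d * (1 - p)) := by
    apply qn_of_pow _ n
    have : (d * (1 - p)) ^ n = (1 - p) * (d ^ n - p) := by
      rw [hde.mul_pow, IsIdempotentElem.pow_eq hee (by omega), mul_sub (1 - p), hpe, sub_zero,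
        (hde.pow_left n).eq]
    rw [this]
    apply qn_mul_s7 _ _ _ hq
    exact (hde.symm.pow_right n).sub_right (((Commute.one_left p).sub_left (Commute.refl p)))
  obtain ⟨M, hM, hk⟩ := qn_growth _ hqe (1 / 2 / (‖x‖ + 1)) (by positivity)
  intro z hz
  have hzd : Commute z d := hz
  have hpk : ∀ k : ℕ, p = d ^ (k+1) * x ^ (k+1) := fun k => by
    rw [← hcd.mul_pow, ← hp, IsIdempotentElem.pow_eq hpp (by omega)]
  have hek : ∀ k : ℕ, d ^ (k+1) * (1 - p) = (d * (1 - p)) ^ (k+1) := fun k => by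
    rw [hde.mul_pow, IsIdempotentElem.pow_eq hee (by omega)]
  have hbd : ∀ k : ℕ, ‖x ^ (k+1)‖ * ‖z‖ * ‖(d * (1 - p)) ^ (k+1)‖ ≤
      ((‖(1:A)‖ + 1) * ‖z‖ * M) * (1/2) ^ k := by
    intro k
    calc _ ≤ ((‖(1 : A)‖ + 1) * (‖x‖ + 1) ^ (k+1)) * ‖z‖ * (M * (1 / 2 / (‖x‖ + 1)) ^ (k+1)) := by
          gcongr
          · exact norm_pow_le_aux x _
          · exact hk _
      _ = ((‖(1:A)‖ + 1) * ‖z‖ * M) * (1/2) ^ (k+1) := by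
          rw [div_pow _ (‖x‖ + 1)]
          have : (‖x‖ + 1) ^ (k+1) ≠ 0 := by positivity
          field_simp
      _ ≤ _ := by
          have : ((1:ℝ)/2) ^ (k+1) ≤ (1/2)^k := pow_le_pow_of_le_one (by norm_num) (by norm_num) (by omega)
          gcongr
  have e1 : p * z * (1 - p) = 0 := by
    apply norm_zero_of_bound _ _ (fun k => le_trans ?_ (hbd k))
    have : p * z * (1 - p) = x ^ (k+1) * z * (d * (1 - p)) ^ (k+1) := by
      conv_lhs => enter [1, 1]; rw [hpk k]
      rw [(hcd.pow_pow (k+1) (k+1)).eq, ← hek]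
      have := (hzd.pow_right (k+1)).eq
      simp only [mul_assoc]
      rw [← mul_assoc z, this]
      simp only [mul_assoc]
    rw [this]
    exact (norm_mul_le _ _).trans (mul_le_mul_of_nonneg_right (norm_mul_le _ _) (norm_nonneg _))
  have e2 : (1 - p) * z * p = 0 := by
    apply norm_zero_of_bound _ _ (fun k => le_trans ?_ (hbd k))
    have : (1 - p) * z * p = (d * (1 - p)) ^ (k+1) * z * x ^ (k+1) := by
      conv_lhs => enter [2]; rw [hpk k]
      rw [← hek, (hde.pow_left (k+1)).eq]
      have := (hzd.pow_right (k+1)).eq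
      simp only [mul_assoc]
      rw [← mul_assoc z, this]
      simp only [mul_assoc]
    rw [this]
    calc _ ≤ ‖(d * (1 - p)) ^ (k+1)‖ * ‖z‖ * ‖x ^ (k+1)‖ :=
          (norm_mul_le _ _).trans (mul_le_mul_of_nonneg_right (norm_mul_le _ _) (norm_nonneg _))
      _ = _ := by ring
  have hpz : p * z = z * p := by
    rw [mul_sub, mul_one, sub_eq_zero] at e1
    rw [sub_mul, sub_mul, one_mul, sub_eq_zero] at e2
    rw [e1, e2]
  have hxp : x * p = x := by rw [hp, ← mul_assoc, hx]
  have hpx : p * x = x := by rw [hc, hx]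
  calc x * z = x * (p * z) := by rw [← mul_assoc, hxp]
    _ = x * (z * d) * x := by rw [hpz, hp]; simp only [mul_assoc]
    _ = p * z * x := by rw [hz, hc]; simp only [mul_assoc]
    _ = z * x := by rw [hpz, mul_assoc, hpx]

theorem exists_T (a b y c p : A) (hby : b * y = p) (hpy : p * y = y) (hap : a * p = 0)
    (hcp : c * p = 0) (hc : IsQuasinilpotent c) :
    ∃ T : A, p * T = T ∧ T * p = 0 ∧ b * T = y * a + T * c := by
  obtain ⟨M, hM, hk⟩ := qn_growth c hc (1 / 2 / (‖y‖ + 1)) (by positivity)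
  have hsum : Summable (fun k : ℕ => y ^ (k+2) * a * c ^ k) := by
    refine Summable.of_norm_bounded
      (g := fun k : ℕ => ((‖(1:A)‖ + 1) * (‖y‖ + 1)^2 * ‖a‖ * M) * (1/2 : ℝ) ^ k)
      ((summable_geometric_of_lt_one (by norm_num) (by norm_num)).mul_left _) (fun k => ?_)
    calc _ ≤ ‖y ^ (k+2)‖ * ‖a‖ * ‖c ^ k‖ :=
          (norm_mul_le _ _).trans (mul_le_mul_of_nonneg_right (norm_mul_le _ _) (norm_nonneg _))
      _ ≤ ((‖(1 : A)‖ + 1) * (‖y‖ + 1) ^ (k+2)) * ‖a‖ * (M * (1 / 2 / (‖y‖ + 1)) ^ k) := by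
          gcongr
          · exact norm_pow_le_aux y _
          · exact hk _
      _ = _ := by
          rw [div_pow _ (‖y‖ + 1), pow_add]
          have : (‖y‖ + 1) ^ k ≠ 0 := by positivity
          field_simp
  refine ⟨∑' k : ℕ, y ^ (k+2) * a * c ^ k, ?_, ?_, ?_⟩
  · rw [← hsum.tsum_mul_left]
    congr 1; ext k
    rw [pow_succ' y (k+1)]
    simp only [← mul_assoc, hpy]
  · rw [← hsum.tsum_mul_right]
    have : ∀ k : ℕ, y ^ (k+2) * a * c ^ k * p = 0 := by
      intro k
      rcases k with _ | k
      · simp [mul_assoc, hap]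
      · rw [pow_succ c, mul_assoc, mul_assoc _ c, hcp]; simp
    simp [this]
  · rw [← hsum.tsum_mul_left, (hsum.mul_left b).tsum_eq_zero_add, ← hsum.tsum_mul_right]
    congr 1
    · simp only [pow_zero, mul_one, zero_add, pow_two, ← mul_assoc]
      rw [hby, hpy]
    · congr 1; ext k
      rw [pow_succ' y (k+1+1), pow_succ' y (k+1), pow_succ c]
      simp only [← mul_assoc]
      rw [hby, hpy]

theorem isGnsDrazinInvertible_add_of_quasinilpotent (n : ℕ) (hn : 1 ≤ n) (a b y : A)
    (ha : IsQuasinilpotent a)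
    (hy : (∀ z : A, z * b = b * z → y * z = z * y) ∧ y * b * y = y ∧
      IsQuasinilpotent (b ^ n - b * y))
    (h1 : a = a * (1 - b * y))
    (h2 : (1 - b * y) * b * a = (1 - b * y) * a * b) :
    IsGnsDrazinInvertible n (a + b) := by
  have hnt : Nontrivial A := by
    by_contra hc
    rw [not_nontrivial_iff_subsingleton] at hc
    unfold IsQuasinilpotent at ha
    rw [spectrum.of_subsingleton] at ha
    exact (Set.singleton_nonempty (0:ℂ)).ne_empty ha.symm
  obtain ⟨hy1, hy2, hy3⟩ := hy
  have hyb : y * b = b * y := hy1 b rfl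
  obtain ⟨p, hp⟩ : ∃ p, p = b * y := ⟨_, rfl⟩
  rw [← hp] at hyb hy3 h1 h2
  have hpy : p * y = y := by rw [← hyb, hy2]
  have hpp : p * p = p := by
    calc p * p = b * (y * b * y) := by rw [hp]; simp only [mul_assoc]
      _ = p := by rw [hy2, hp]
  have hbp : Commute b p := by
    show b * p = p * b
    nth_rw 2 [hp]; rw [mul_assoc, hyb]
  have hap : a * p = 0 := by
    rw [mul_sub, mul_one] at h1
    exact sub_eq_self.1 h1.symm
  obtain ⟨e, he⟩ : ∃ e, e = 1 - p := ⟨_, rfl⟩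
  rw [← he] at h1 h2
  have hpe : p * e = 0 := by rw [he, mul_sub, hpp, mul_one, sub_self]
  have hep : e * p = 0 := by rw [he, sub_mul, hpp, one_mul, sub_self]
  have hee : e * e = e := by nth_rw 2 [he]; rw [mul_sub, hep]; simp
  have hbe : Commute b e := by rw [he]; exact (Commute.one_right b).sub_right hbp
  -- diagonal parts
  have hea : IsQuasinilpotent (e * a) := by
    apply qn_swap; rw [← h1]; exact ha
  have hebq : IsQuasinilpotent (e * b) := by
    apply qn_of_pow _ n
    have : (e * b) ^ n = e * (b ^ n - p) := by
      rw [hbe.symm.mul_pow, IsIdempotentElem.pow_eq hee (by omega), mul_sub, hep, sub_zero]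
    rw [this]
    exact qn_mul_s7 _ _ ((hbe.symm.pow_right n).sub_right (by rw [Commute, SemiconjBy, hep, hpe])) hy3
  have hpq : IsQuasinilpotent (p * (b ^ n - p)) :=
    qn_mul_s7 _ _ ((hbp.symm.pow_right n).sub_right (Commute.refl p)) hy3
  obtain ⟨c, hcdef⟩ : ∃ c, c = e * (a + b) := ⟨_, rfl⟩
  have hcq : IsQuasinilpotent c := by
    rw [hcdef, mul_add]
    apply qn_add _ _ _ hea hebq
    show e * a * (e * b) = e * b * (e * a)
    calc e * a * (e * b) = e * (a * e) * b := by simp only [mul_assoc]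
      _ = e * b * a := by rw [← h1, h2]
      _ = b * e * e * a := by rw [mul_assoc b, hee, hbe.eq]
      _ = e * b * (e * a) := by rw [hbe.eq]; simp only [mul_assoc]
  have hcp : c * p = 0 := by
    rw [hcdef, mul_assoc, add_mul, hap, hbp.eq, zero_add, ← mul_assoc, hep, zero_mul]
  obtain ⟨T, hpT, hTp, hbT⟩ := exists_T a b y c p hp.symm hpy hap hcp hcq
  have hTe : T * e = T := by rw [he, mul_sub, hTp]; simp
  have hay : a * y = 0 := by rw [← hpy, ← mul_assoc, hap, zero_mul]
  have haT : a * T = 0 := by rw [← hpT, ← mul_assoc, hap, zero_mul]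
  have hcy : c * y = 0 := by rw [← hpy, ← mul_assoc, hcp, zero_mul]
  have hcT : c * T = 0 := by rw [← hpT, ← mul_assoc, hcp, zero_mul]
  have hdx : (a + b) * (y + T) = p + y * a + T * c := by
    rw [add_mul, mul_add, mul_add, hay, haT, hbT, ← hp]; abel
  have hxd : (y + T) * (a + b) = p + y * a + T * c := by
    rw [add_mul, hcdef, ← mul_assoc T, hTe, mul_add y, hyb]; abel
  have hxdx : (y + T) * (a + b) * (y + T) = y + T := by
    rw [hxd]
    simp only [add_mul, mul_add, mul_assoc, hay, haT, hcy, hcT, hpy, hpT]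
    simp
  have hq : IsQuasinilpotent ((a + b) ^ n - (a + b) * (y + T)) := by
    have hey : e * y = 0 := by rw [← hpy, ← mul_assoc, hep, zero_mul]
    have heT : e * T = 0 := by rw [← hpT, ← mul_assoc, hep, zero_mul]
    have hedx : e * ((a + b) * (y + T)) = 0 := by
      rw [hdx, mul_add, mul_add, hep, ← mul_assoc, ← mul_assoc, hey, heT]; simp
    have hce : c * e = c := by rw [he, mul_sub, hcp]; simp
    have hdp : ∀ k : ℕ, (a + b) ^ k * p = b ^ k * p := by
      intro k
      induction k with
      | zero => simp
      | succ k ih =>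
        rw [pow_succ, mul_assoc, add_mul, hap, zero_add, hbp.eq, ← mul_assoc, ih, pow_succ,
          mul_assoc, mul_assoc, hbp.eq]
    have hed : ∀ k : ℕ, e * (a + b) ^ (k+1) = c ^ (k+1) := by
      intro k
      induction k with
      | zero => simp [hcdef]
      | succ k ih =>
        have hcc : c * (a + b) = c * c := by
          calc c * (a + b) = c * e * (a + b) := by rw [hce]
            _ = c * (e * (a + b)) := mul_assoc _ _ _
            _ = c * c := by rw [← hcdef]
        rw [pow_succ, ← mul_assoc, ih, pow_succ c (k+1), pow_succ c k, mul_assoc, hcc, mul_assoc]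
    obtain ⟨m, rfl⟩ := Nat.exists_eq_add_of_le' hn
    have het : e * ((a + b) ^ (m+1) - (a + b) * (y + T)) = c ^ (m+1) := by
      rw [mul_sub, hedx, hed, sub_zero]
    apply qn_block p _ hpp
    · rw [← he, het, pow_succ, mul_assoc, hcp, mul_zero]
    · have : p * ((a + b) ^ (m+1) - (a + b) * (y + T)) * p = p * (b ^ (m+1) - p) := by
        rw [mul_assoc, sub_mul, hdp, hdx]
        simp only [add_mul, mul_assoc, hap, hcp, hpp, mul_zero, add_zero]
        rw [mul_sub, (hbp.pow_left (m+1)).eq, ← mul_assoc, hpp, mul_sub, hpp]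
      rw [this]; exact hpq
    · rw [← he, het, pow_succ, mul_assoc, hce, ← pow_succ]
      exact qn_pow _ _ hn hcq
  exact ⟨y + T, bicomm_s7 n hn _ _ (hdx.trans hxd.symm) hxdx hq, hxdx, hq⟩
end

section
/- Let 𝒜 be a complex unital Banach algebra, let n ≥ 1 be an integer, let b ∈ 𝒜 be gns-Drazin invertible with gns-Drazin inverse y, and let a ∈ 𝒜 be quasinilpotent; set b^π = 1 − b y. If a b^π = a and b^π a b = 0, then a + b is gns-Drazin invertible. -/
variable {A : Type*} [NormedRing A] [NormedAlgebra ℂ A] [CompleteSpace A]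

/-- Resolvent form of quasinilpotence. -/
def QNU (q : A) : Prop := ∀ l : ℂ, IsUnit (1 - l • q)

theorem qnu_of {q : A} (h : IsQuasinilpotent q) : QNU q := by
  intro l
  by_cases hl : l = 0
  · simp [hl]
  have h1 : l⁻¹ ∉ spectrum ℂ q := by
    rw [h]; simpa using hl
  rw [spectrum.notMem_iff] at h1
  have h2 : (1 : A) - l • q = l • (algebraMap ℂ A l⁻¹ - q) := by
    rw [Algebra.algebraMap_eq_smul_one, smul_sub, smul_smul, mul_inv_cancel₀ hl, one_smul]
  rw [h2]
  exact (isUnit_smul_iff (Units.mk0 l hl) _).2 h1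

theorem qn_of [Nontrivial A] {q : A} (h : QNU q) : IsQuasinilpotent q := by
  have hs : spectrum ℂ q ⊆ {0} := by
    intro l hl
    by_contra hne
    have hne : l ≠ 0 := by simpa using hne
    have h2 : algebraMap ℂ A l - q = l • ((1 : A) - l⁻¹ • q) := by
      rw [Algebra.algebraMap_eq_smul_one, smul_sub, smul_smul, mul_inv_cancel₀ hne, one_smul]
    apply hl
    change IsUnit (algebraMap ℂ A l - q)
    rw [h2]
    exact (isUnit_smul_iff (Units.mk0 l hne) _).2 (h _)
  exact (spectrum.nonempty q).subset_singleton_iff.1 hs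

theorem qnu_mul_comm {u v : A} (h : QNU (u * v)) : QNU (v * u) := by
  intro l
  have h1 := h l
  rw [← smul_mul_assoc] at h1
  obtain ⟨w, hw1, hw2⟩ := isUnit_iff_exists.1 h1
  rw [isUnit_iff_exists]
  refine ⟨1 + v * w * (l • u), ?_, ?_⟩
  · have : (1 - l • (v * u)) * (1 + v * w * (l • u))
      = 1 - l • (v * u) + v * ((1 - l • u * v) * w) * (l • u) := by
      simp only [smul_mul_assoc, mul_smul_comm, mul_sub, sub_mul, mul_add, one_mul, mul_one, mul_assoc]
    rw [this, hw1]
    simp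
  · have : (1 + v * w * (l • u)) * (1 - l • (v * u))
      = 1 - l • (v * u) + v * (w * (1 - l • u * v)) * (l • u) := by
      simp only [smul_mul_assoc, mul_smul_comm, mul_sub, sub_mul, add_mul, one_mul, mul_one, mul_assoc,
        smul_add, smul_sub]
      abel
    rw [this, hw2]
    simp

theorem one_sub_fac {u v : A} (l : ℂ) (h : u * v = 0) :
    (1 - l • u) * (1 - l • v) = 1 - l • (u + v) := by
  simp only [mul_sub, sub_mul, one_mul, mul_one, smul_mul_smul_comm, h, smul_add, smul_zero]
  abel

theorem qnu_add {u v : A} (hu : QNU u) (hv : QNU v) (h : u * v = 0) : QNU (u + v) := by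
  intro l
  rw [← one_sub_fac l h]
  exact (hu l).mul (hv l)

theorem qnu_idem {e q : A} (he : e * e = e) (hc : e * q = q * e) (hq : QNU q) : QNU (e * q) := by
  intro l
  have hz : e * q * ((1 - e) * q) = 0 := by
    rw [hc, mul_assoc, ← mul_assoc e, mul_sub, he]; simp
  have hz' : (1 - e) * q * (e * q) = 0 := by
    rw [mul_assoc, ← mul_assoc q, ← hc, ← mul_assoc, ← mul_assoc, sub_mul, he]; simp
  have hs : e * q + (1 - e) * q = q := by noncomm_ring
  have hs' : (1 - e) * q + e * q = q := by noncomm_ring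
  have h1 := one_sub_fac l hz
  have h2 := one_sub_fac l hz'
  rw [hs] at h1
  rw [hs'] at h2
  have hcm : Commute (1 - l • (e * q)) (1 - l • ((1 - e) * q)) := h1.trans h2.symm
  exact (hcm.isUnit_mul_iff.1 (h1 ▸ hq l)).1

theorem qnu_pow [Nontrivial A] {q : A} (hq : QNU q) {n : ℕ} (hn : 1 ≤ n) : QNU (q ^ n) := by
  apply qnu_of
  have := qn_of hq
  unfold IsQuasinilpotent at *
  rw [spectrum.map_pow_of_pos q hn, this]
  simp [Nat.ne_of_gt hn]

theorem qnu_of_pow [Nontrivial A] {q : A} {n : ℕ} (hn : 1 ≤ n) (hq : QNU (q ^ n)) : QNU q := by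
  apply qnu_of
  have := qn_of hq
  unfold IsQuasinilpotent at *
  refine (spectrum.nonempty q).subset_singleton_iff.1 ?_
  intro l hl
  have h1 := spectrum.pow_mem_pow q n hl
  rw [this] at h1
  exact pow_eq_zero_iff (Nat.ne_of_gt hn) |>.1 h1

open Filter Topology in
theorem qnu_summable [Nontrivial A] {q : A} (hq : QNU q) (M : ℝ) (hM : 0 ≤ M) :
    Summable (fun k : ℕ => M ^ k * ‖q ^ k‖) := by
  have h0 : spectralRadius ℂ q = 0 := by
    have := qn_of hq
    unfold IsQuasinilpotent at this
    simp [spectralRadius, this]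
  have ht := spectrum.pow_norm_pow_one_div_tendsto_nhds_spectralRadius q
  rw [h0] at ht
  have hr : (0 : ENNReal) < ENNReal.ofReal (1 / (2 * (M + 1))) := by
    rw [ENNReal.ofReal_pos]; positivity
  have hev := ht.eventually (gt_mem_nhds hr)
  have hg : Summable (fun k : ℕ => (1 / 2 : ℝ) ^ k) := summable_geometric_two
  refine Summable.of_norm_bounded_eventually_nat hg ?_
  filter_upwards [hev, eventually_gt_atTop 0] with k hk hk0
  rw [ENNReal.ofReal_lt_ofReal_iff (by positivity)] at hk
  have h1 : ‖q ^ k‖ ≤ (1 / (2 * (M + 1))) ^ k := by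
    have h2 : (‖q ^ k‖ ^ (1 / (k : ℝ))) ^ k = ‖q ^ k‖ := by
      rw [one_div]
      exact Real.rpow_inv_natCast_pow (norm_nonneg _) (Nat.ne_of_gt hk0)
    rw [← h2]
    exact pow_le_pow_left₀ (by positivity) hk.le k
  rw [Real.norm_of_nonneg (by positivity)]
  calc M ^ k * ‖q ^ k‖ ≤ M ^ k * (1 / (2 * (M + 1))) ^ k := by gcongr
    _ = (M * (1 / (2 * (M + 1)))) ^ k := (mul_pow _ _ _).symm
    _ ≤ (1 / 2) ^ k := by
      gcongr
      rw [mul_one_div, div_le_div_iff₀ (by positivity) (by positivity)]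
      linarith

theorem norm_pow_bound (x t q : A) (k : ℕ) :
    ‖x ^ (k + 1) * t * q ^ (k + 1)‖ ≤ ‖t‖ * (‖x‖ ^ (k + 1) * ‖q ^ (k + 1)‖) := by
  calc ‖x ^ (k + 1) * t * q ^ (k + 1)‖ ≤ ‖x ^ (k + 1)‖ * ‖t‖ * ‖q ^ (k + 1)‖ :=
        (norm_mul_le _ _).trans (by gcongr; exact norm_mul_le _ _)
    _ ≤ ‖x‖ ^ (k + 1) * ‖t‖ * ‖q ^ (k + 1)‖ := by
        gcongr; exact norm_pow_le' _ (Nat.succ_pos k)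
    _ = _ := by ring

theorem sylvester_exists [Nontrivial A] {q : A} (hq : QNU q) (x t : A) :
    ∃ s : A, s = t + x * s * q := by
  have hs : Summable (fun k : ℕ => x ^ k * t * q ^ k) := by
    rw [← summable_nat_add_iff 1]
    refine Summable.of_norm_bounded ?_ (norm_pow_bound x t q)
    exact (((summable_nat_add_iff 1).2 (qnu_summable hq ‖x‖ (norm_nonneg _))).mul_left ‖t‖)
  refine ⟨∑' k : ℕ, x ^ k * t * q ^ k, ?_⟩
  conv_lhs => rw [hs.tsum_eq_zero_add]
  rw [← hs.tsum_mul_left, ← (hs.mul_left x).tsum_mul_right]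
  congr 1
  · simp
  · refine tsum_congr fun k => ?_
    rw [pow_succ', pow_succ]; simp only [mul_assoc]

open Filter Topology in
theorem sylvester_zero [Nontrivial A] {q : A} (hq : QNU q) (x t : A)
    (h : t = x * t * q) : t = 0 := by
  have hk : ∀ k : ℕ, x ^ k * t * q ^ k = t := by
    intro k
    induction k with
    | zero => simp
    | succ k ih =>
      calc x ^ (k + 1) * t * q ^ (k + 1) = x ^ k * (x * t * q) * q ^ k := by
            rw [pow_succ, pow_succ']; simp only [mul_assoc]
        _ = t := by rw [← h, ih]
  have hs := (((summable_nat_add_iff 1).2 (qnu_summable hq ‖x‖ (norm_nonneg _))).mul_left ‖t‖)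
  have ht := hs.tendsto_atTop_zero
  have : ‖t‖ ≤ 0 := by
    refine ge_of_tendsto' ht fun k => ?_
    have := norm_pow_bound x t q k
    rwa [hk] at this
  exact norm_le_zero_iff.1 this

open Filter Topology in
theorem sylvester_zero' [Nontrivial A] {q : A} (hq : QNU q) (x t : A)
    (h : t = q * t * x) : t = 0 := by
  have hk : ∀ k : ℕ, q ^ k * t * x ^ k = t := by
    intro k
    induction k with
    | zero => simp
    | succ k ih =>
      calc q ^ (k + 1) * t * x ^ (k + 1) = q ^ k * (q * t * x) * x ^ k := by
            rw [pow_succ, pow_succ']; simp only [mul_assoc]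
        _ = t := by rw [← h, ih]
  have hs := (((summable_nat_add_iff 1).2 (qnu_summable hq ‖x‖ (norm_nonneg _))).mul_left ‖t‖)
  have ht := hs.tendsto_atTop_zero
  have : ‖t‖ ≤ 0 := by
    refine ge_of_tendsto' ht fun k => ?_
    calc ‖t‖ = ‖q ^ (k + 1) * t * x ^ (k + 1)‖ := by rw [hk]
      _ ≤ ‖q ^ (k + 1)‖ * ‖t‖ * ‖x ^ (k + 1)‖ :=
        (norm_mul_le _ _).trans (by gcongr; exact norm_mul_le _ _)
      _ ≤ ‖q ^ (k + 1)‖ * ‖t‖ * ‖x‖ ^ (k + 1) := by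
        gcongr; exact norm_pow_le' _ (Nat.succ_pos k)
      _ = _ := by ring
  exact norm_le_zero_iff.1 this

theorem isGnsDrazinInvertible_add_of_quasinilpotent' (n : ℕ) (hn : 1 ≤ n) (a b y : A)
    (hy : (∀ z : A, z * b = b * z → y * z = z * y) ∧ y * b * y = y ∧
      IsQuasinilpotent (b ^ n - b * y))
    (ha : IsQuasinilpotent a)
    (h1 : a * (1 - b * y) = a)
    (h2 : (1 - b * y) * a * b = 0) :
    IsGnsDrazinInvertible n (a + b) := by
  haveI : Nontrivial A := by
    by_contra hN
    rw [not_nontrivial_iff_subsingleton] at hN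
    have : (0 : ℂ) ∈ spectrum ℂ a := by rw [ha]; rfl
    exact this (isUnit_of_subsingleton _)
  obtain ⟨hyc, hyy, hbq⟩ := hy
  have ha := qnu_of ha
  have hbq := qnu_of hbq
  have hyb : y * b = b * y := hyc b rfl
  obtain ⟨e, he⟩ : ∃ e, e = b * y := ⟨_, rfl⟩
  rw [← he] at h1 h2 hbq
  have hey : e * y = y := by rw [he, ← hyb, hyy]
  have hye : y * e = y := by rw [he, ← mul_assoc, hyy]
  have heb : e * b = b * e := by rw [he, mul_assoc, hyb]
  have hee : e * e = e := by
    calc e * e = b * (y * e) := by rw [← mul_assoc, ← he]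
      _ = e := by rw [hye, he]
  have hae : a * e = 0 := by
    rw [mul_sub, mul_one] at h1
    exact sub_eq_self.1 h1
  have hebn : e * b ^ n = b ^ n * e := ((show Commute e b from heb).pow_right n)
  have hpp : (1 - e) * (1 - e) = 1 - e := by simp [mul_sub, sub_mul, hee]
  have hpb : (1 - e) * b = b * (1 - e) := by rw [sub_mul, mul_sub, heb, one_mul, mul_one]
  have hcomm : (1 - e) * (b ^ n - e) = (b ^ n - e) * (1 - e) := by
    simp only [sub_mul, mul_sub, hebn, hee, one_mul, mul_one]; abel
  -- `p * b` quasinilpotent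
  have hpbq : QNU ((1 - e) * b) := by
    apply qnu_of_pow hn
    have h3 := qnu_idem hpp hcomm hbq
    have h4 : ((1 - e) * b) ^ n = (1 - e) * (b ^ n - e) := by
      rw [(show Commute (1 - e) b from hpb).mul_pow,
        (show IsIdempotentElem (1 - e) from hpp).pow_eq (by omega)]
      simp [mul_sub, sub_mul, hee]
    rwa [h4]
  have hpaq : QNU ((1 - e) * a) := qnu_mul_comm (by rwa [h1])
  obtain ⟨c, hc⟩ : ∃ c, c = a + b := ⟨_, rfl⟩
  rw [← hc]
  obtain ⟨d, hd⟩ : ∃ d, d = (1 - e) * c := ⟨_, rfl⟩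
  have hdq : QNU d := by
    rw [hd, hc, mul_add]
    refine qnu_add hpaq hpbq ?_
    rw [mul_assoc, ← mul_assoc a, h1, ← mul_assoc, h2]
  have hce : c * e = b * e := by rw [hc, add_mul, hae, zero_add]
  have hde : d * e = 0 := by
    rw [hd, mul_assoc, hce, ← heb, ← mul_assoc, sub_mul, one_mul, hee, sub_self, zero_mul]
  obtain ⟨s, hs⟩ := sylvester_exists hdq y (y * a)
  have hes : e * s = s := by
    conv_lhs => rw [hs]
    rw [mul_add, mul_assoc y, ← mul_assoc e, ← mul_assoc e, hey, ← mul_assoc]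
    exact hs.symm
  have hse : s * e = 0 := by
    rw [hs, add_mul, mul_assoc, hae, mul_assoc, hde]; simp
  have hbs : b * s = e * a + s * d := by
    conv_lhs => rw [hs]
    rw [mul_add, mul_assoc y, ← mul_assoc b, ← mul_assoc b, ← he, ← mul_assoc, hes]
  have hss : s * s = 0 := by
    conv_lhs => rw [← hes]
    rw [mul_assoc e, ← mul_assoc s, hse]; simp
  have hds : d * s = 0 := by rw [← hes, ← mul_assoc, hde, zero_mul]
  obtain ⟨f, hf⟩ : ∃ f, f = e + s := ⟨_, rfl⟩
  have hef : e * f = f := by rw [hf, mul_add, hee, hes]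
  have hfe : f * e = e := by rw [hf, add_mul, hee, hse, add_zero]
  have hff : f * f = f := by
    rw [hf, mul_add, add_mul, add_mul, hee, hse, hes, hss]; simp
  have hcf : c * f = b * f := by rw [← hef, ← mul_assoc, ← mul_assoc, hce]
  have hsc : s * c = s * d := by
    rw [hd, ← mul_assoc, mul_sub, hse, mul_one, sub_zero]
  have hfc : f * c = c * f := by
    rw [hcf, hf, mul_add, hbs, add_mul, hsc, ← heb, hc, mul_add]; abel
  have hfy : f * y = y := by rw [← hey, ← mul_assoc, hfe]
  obtain ⟨x, hx⟩ : ∃ x, x = y * f := ⟨_, rfl⟩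
  have hfx : f * x = x := by rw [hx, ← mul_assoc, hfy]
  have hxf : x * f = x := by rw [hx, mul_assoc, hff]
  have hcx : c * x = f := by
    rw [hx, ← mul_assoc, ← hey, ← mul_assoc c, hce, mul_assoc b, hey, ← he, hef]
  have hxc : x * c = f := by
    rw [hx, mul_assoc, hfc, hcf, ← mul_assoc, hyb, ← he, hef]
  obtain ⟨q, hq⟩ : ∃ q, q = c * (1 - f) := ⟨_, rfl⟩
  have hq2 : q = (1 - f) * c := by rw [hq, mul_sub, sub_mul, hfc]; simp
  have hqq : QNU q := by
    have h5 : q = (1 - s) * d := by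
      rw [hq2, sub_mul 1 s, ← hsc, hd, hf]; noncomm_ring
    rw [h5]
    apply qnu_mul_comm
    rwa [mul_sub, hds, mul_one, sub_zero]
  have hqf : q * (1 - f) = q := by
    rw [hq, mul_assoc]; congr 1; simp [mul_sub, sub_mul, hff]
  have hpq : (1 - f) * q = q := by
    rw [hq2, ← mul_assoc]; congr 1; simp [mul_sub, sub_mul, hff]
  refine ⟨x, ?_, ?_, ?_⟩
  · intro z hz
    have t1 : f * z * (1 - f) = 0 := by
      apply sylvester_zero hqq x
      calc f * z * (1 - f) = x * (c * z) * (1 - f) := by rw [← mul_assoc, hxc]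
        _ = x * f * z * (c * (1 - f)) := by rw [← hz, hxf]; simp only [mul_assoc]
        _ = x * f * z * ((1 - f) * q) := by rw [← hq, hpq]
        _ = x * (f * z * (1 - f)) * q := by simp only [mul_assoc]
    have t2 : (1 - f) * z * f = 0 := by
      apply sylvester_zero' hqq x
      calc (1 - f) * z * f = (1 - f) * (z * c) * x := by rw [← hcx]; simp only [mul_assoc]
        _ = ((1 - f) * c) * z * (f * x) := by rw [hz, hfx]; simp only [mul_assoc]
        _ = q * (1 - f) * z * (f * x) := by rw [← hq2, hqf]
        _ = q * ((1 - f) * z * f) * x := by simp only [mul_assoc]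
    have hfz : f * z = z * f := by
      rw [mul_sub, mul_one, sub_eq_zero] at t1
      rw [sub_mul, sub_mul, one_mul, sub_eq_zero] at t2
      rw [t1, t2]
    calc x * z = x * (f * z) := by rw [← mul_assoc, hxf]
      _ = x * (z * c) * x := by rw [hfz, ← hcx]; simp only [mul_assoc]
      _ = x * c * z * x := by rw [hz]; simp only [mul_assoc]
      _ = z * x := by rw [hxc, hfz, mul_assoc, hfx]
  · rw [hxc, hfx]
  · apply qn_of
    have hcnf : ∀ k : ℕ, c ^ k * f = b ^ k * f := by
      intro k
      induction k with
      | zero => simp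
      | succ k ih =>
        calc c ^ (k + 1) * f = c ^ k * (c * f) := by rw [pow_succ, mul_assoc]
          _ = c ^ k * f * (c * f) := by
            rw [mul_assoc, ← mul_assoc f, hfc, mul_assoc c, hff]
          _ = b ^ k * (f * c * f) := by rw [ih]; simp only [mul_assoc]
          _ = b ^ (k + 1) * f := by
            rw [hfc, mul_assoc c, hff, hcf, pow_succ, mul_assoc]
    have hqn : q ^ n = c ^ n * (1 - f) := by
      rw [hq, (show Commute c (1 - f) from hq.symm.trans hq2).mul_pow,
        (show IsIdempotentElem (1 - f) by
          simp [IsIdempotentElem, mul_sub, sub_mul, hff]).pow_eq (by omega)]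
    have hsplit : c ^ n - c * x = (b ^ n - e) * f + q ^ n := by
      rw [hqn, hcx, mul_sub, hcnf, sub_mul, hef]; noncomm_ring
    rw [hsplit]
    have hfq : f * q ^ n = 0 := by
      have : f * q = 0 := by rw [← hpq, ← mul_assoc, mul_sub, hff]; simp
      obtain ⟨m, rfl⟩ : ∃ m, n = m + 1 := ⟨n - 1, by omega⟩
      rw [pow_succ', ← mul_assoc, this, zero_mul]
    refine qnu_add ?_ (qnu_pow hqq hn) (by rw [mul_assoc, hfq, mul_zero])
    have hce2 : e * (b ^ n - e) = (b ^ n - e) * e := by rw [mul_sub, sub_mul, hebn]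
    have h6 : (b ^ n - e) * f = (b ^ n - e) * e * f := by rw [mul_assoc, hef]
    rw [h6]
    apply qnu_mul_comm
    rw [← hce2, ← mul_assoc, hfe]
    exact qnu_idem hee hce2 hbq
end

section
/- Let 𝒜 be a complex unital Banach algebra, let n ≥ 1 be an integer, and let a, b ∈ 𝒜 both be gns-Drazin invertible with gns-Drazin inverses x and y respectively; set a^π = 1 − a x and b^π = 1 − b y. If a = a b^π, b = b a^π, and b^π a b a^π = 0, then a + b is gns-Drazin invertible. -/
variable {A : Type*} [NormedRing A] [NormedAlgebra ℂ A] [CompleteSpace A]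

set_option linter.unusedSectionVars false
set_option linter.unusedSimpArgs false

/-- Working form of quasinilpotency. -/
def QN (u : A) : Prop := ∀ l : ℂ, l ≠ 0 → IsUnit (algebraMap ℂ A l - u)

theorem IsQuasinilpotent.qn {u : A} (h : IsQuasinilpotent u) : QN u := by
  intro l hl
  by_contra hc
  have : l ∈ spectrum ℂ u := hc
  rw [IsQuasinilpotent] at h
  rw [h] at this
  exact hl this

theorem QN.eq_zero {u : A} (h : QN u) {l : ℂ} (hl : l ∈ spectrum ℂ u) : l = 0 := by
  by_contra hc
  exact hl (h l hc)

theorem QN.isQuasinilpotent [Nontrivial A] {u : A} (h : QN u) : IsQuasinilpotent u := by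
  obtain ⟨l, hl⟩ := spectrum.nonempty u
  have h0 := h.eq_zero hl
  subst h0
  exact Set.Subset.antisymm (fun l hl => h.eq_zero hl) (by simpa using hl)

theorem QN.of_pow {u : A} {n : ℕ} (h : QN (u ^ n)) : QN u := by
  intro l hl
  by_contra hc
  exact hl (pow_eq_zero_iff_of_pos' (h.eq_zero (spectrum.pow_mem_pow u n hc)))
where
  pow_eq_zero_iff_of_pos' {l : ℂ} {n : ℕ} (h : l ^ n = 0) : l = 0 := eq_zero_of_pow_eq_zero h
  eq_zero_of_pow_eq_zero {l : ℂ} {n : ℕ} (h : l ^ n = 0) : l = 0 := by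
    by_contra hc
    exact pow_ne_zero n hc h

theorem QN.pow {u : A} (h : QN u) {n : ℕ} (hn : 1 ≤ n) : QN (u ^ n) := by
  intro l hl
  by_contra hc
  have hc : l ∈ spectrum ℂ (u ^ n) := hc
  rw [spectrum.map_pow_of_pos u hn] at hc
  obtain ⟨k, hk, rfl⟩ := hc
  have := h.eq_zero hk
  subst this
  apply hl
  simp
  omega

theorem qn_zero : QN (0 : A) := by
  intro l hl
  rw [sub_zero]
  exact (IsUnit.mk0 l hl).map (algebraMap ℂ A)

theorem qn_of_sq {u : A} (h : u * u = 0) : QN u := by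
  apply QN.of_pow (n := 2)
  rw [pow_two, h]
  exact qn_zero

theorem QN.add {u v : A} (hu : QN u) (hv : QN v) (h : u * v = 0) : QN (u + v) := by
  intro l hl
  have h1 := (hu l hl).mul (hv l hl)
  have h2 : (algebraMap ℂ A l - u) * (algebraMap ℂ A l - v)
      = algebraMap ℂ A l * (algebraMap ℂ A l - (u + v)) := by
    have := Algebra.commutes l u
    simp only [mul_sub, sub_mul, mul_add, h, this]
    abel
  rw [h2] at h1
  have h3 : IsUnit (algebraMap ℂ A l) := (IsUnit.mk0 l hl).map (algebraMap ℂ A)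
  obtain ⟨w, hw⟩ := h3
  rw [← hw] at h1 ⊢
  exact (Units.isUnit_units_mul w _).1 h1

theorem QN.mul_idem {u e : A} (hu : QN u) (he : e * e = e) (hc : u * e = e * u) :
    QN (u * e) := by
  intro l hl
  have hcl : Commute (algebraMap ℂ A l) e := Algebra.commutes l e
  have hcl' : Commute (algebraMap ℂ A l⁻¹) e := Algebra.commutes _ e
  have hll : algebraMap ℂ A l * algebraMap ℂ A l⁻¹ = 1 := by
    rw [← map_mul, mul_inv_cancel₀ hl, map_one]
  have hll' : algebraMap ℂ A l⁻¹ * algebraMap ℂ A l = 1 := by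
    rw [← map_mul, inv_mul_cancel₀ hl, map_one]
  obtain ⟨v, hv⟩ := hu l hl
  set L := algebraMap ℂ A l
  set M := algebraMap ℂ A l⁻¹
  have hve : Commute (v : A) e := by
    rw [hv]; exact hcl.sub_left hc
  have hve' : Commute (↑v⁻¹ : A) e := hve.units_inv_left
  have e1 : L - u * e = v * e + L * (1 - e) := by
    rw [hv]; noncomm_ring
  have hf : e * (1 - e) = 0 := by rw [mul_sub, he]; simp
  have hf' : (1 - e) * e = 0 := by rw [sub_mul, he]; simp
  have hff : (1 - e) * (1 - e) = 1 - e := by rw [sub_mul, hf]; simp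
  have hcf : Commute L (1 - e) := (Commute.one_right _).sub_right hcl
  have hcf' : Commute M (1 - e) := (Commute.one_right _).sub_right hcl'
  rw [e1, isUnit_iff_exists]
  refine ⟨↑v⁻¹ * e + M * (1 - e), ?_, ?_⟩
  · have a1 : (v : A) * e * (↑v⁻¹ * e) = e := by
      rw [mul_assoc, ← mul_assoc e, ← hve'.eq, mul_assoc, he, ← mul_assoc, Units.mul_inv, one_mul]
    have a2 : (v : A) * e * (M * (1 - e)) = 0 := by
      rw [hcf'.eq, mul_assoc, ← mul_assoc e, hf]; simp
    have a3 : L * (1 - e) * (↑v⁻¹ * e) = 0 := by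
      rw [hve'.eq, mul_assoc, ← mul_assoc (1 - e), hf']; simp
    have a4 : L * (1 - e) * (M * (1 - e)) = 1 - e := by
      rw [mul_assoc, ← mul_assoc (1 - e), ← hcf'.eq, mul_assoc, hff, ← mul_assoc, hll, one_mul]
    rw [add_mul, mul_add, mul_add, a1, a2, a3, a4]; abel
  · have a1 : (↑v⁻¹ : A) * e * (v * e) = e := by
      rw [mul_assoc, ← mul_assoc e, ← hve.eq, mul_assoc, he, ← mul_assoc, Units.inv_mul, one_mul]
    have a2 : (↑v⁻¹ : A) * e * (L * (1 - e)) = 0 := by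
      rw [hcf.eq, mul_assoc, ← mul_assoc e, hf]; simp
    have a3 : M * (1 - e) * (v * e) = 0 := by
      rw [hve.eq, mul_assoc, ← mul_assoc (1 - e), hf']; simp
    have a4 : M * (1 - e) * (L * (1 - e)) = 1 - e := by
      rw [mul_assoc, ← mul_assoc (1 - e), ← hcf.eq, mul_assoc, hff, ← mul_assoc, hll', one_mul]
    rw [add_mul, mul_add, mul_add, a1, a2, a3, a4]; abel

theorem QN.summable {u : A} (h : QN u) {C : ℝ} (hC : 0 ≤ C) :
    Summable (fun k : ℕ => ‖u ^ k‖ * C ^ k) := by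
  have hr : spectralRadius ℂ u = 0 := by
    rw [spectralRadius]
    simp only [ENNReal.iSup_eq_zero]
    intro l hl
    rw [h.eq_zero hl]; simp
  have ht := spectrum.pow_norm_pow_one_div_tendsto_nhds_spectralRadius u
  rw [hr] at ht
  set δ : ℝ := 1 / (2 * (C + 1)) with hδ
  have hδ0 : 0 < δ := by positivity
  have hev := ht.eventually (gt_mem_nhds (ENNReal.ofReal_pos.2 hδ0))
  refine Summable.of_norm_bounded_eventually_nat (g := fun k => (1 / 2 : ℝ) ^ k)
    summable_geometric_two ?_
  filter_upwards [hev, Filter.eventually_ge_atTop 1] with k hk hk1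
  rw [ENNReal.ofReal_lt_ofReal_iff hδ0] at hk
  have hk0 : (k : ℝ) ≠ 0 := by positivity
  have h1 : ‖u ^ k‖ ≤ δ ^ k := by
    have : ‖u ^ k‖ = (‖u ^ k‖ ^ (1 / (k : ℝ))) ^ k := by
      rw [← Real.rpow_natCast, ← Real.rpow_mul (norm_nonneg _), one_div, inv_mul_cancel₀ hk0,
        Real.rpow_one]
    rw [this]
    exact pow_le_pow_left₀ (by positivity) hk.le k
  rw [Real.norm_of_nonneg (by positivity)]
  calc ‖u ^ k‖ * C ^ k ≤ δ ^ k * C ^ k := by gcongr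
    _ = (δ * C) ^ k := (mul_pow _ _ _).symm
    _ ≤ (1 / 2) ^ k := by
      apply pow_le_pow_left₀ (by positivity)
      rw [hδ, div_mul_eq_mul_div, div_le_div_iff₀ (by positivity) (by positivity)]
      linarith

theorem norm_pow_le_mul (u : A) : ∀ k : ℕ, ∀ z : A, ‖z * u ^ k‖ ≤ ‖z‖ * ‖u‖ ^ k := by
  intro k
  induction k with
  | zero => intro z; simp
  | succ k ih =>
    intro z
    rw [pow_succ', ← mul_assoc]
    refine (ih _).trans ?_
    rw [pow_succ', ← mul_assoc]
    gcongr
    exact norm_mul_le _ _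

theorem norm_pow_le_mul' (u : A) : ∀ k : ℕ, ∀ z : A, ‖u ^ k * z‖ ≤ ‖u‖ ^ k * ‖z‖ := by
  intro k
  induction k with
  | zero => intro z; simp
  | succ k ih =>
    intro z
    rw [pow_succ, mul_assoc]
    refine (ih _).trans ?_
    rw [pow_succ, mul_assoc]
    gcongr
    exact norm_mul_le _ _

theorem QN.eq_zero_of_bound {u v : A} (h : QN u) {C D : ℝ} (hC : 0 ≤ C)
    (hb : ∀ k : ℕ, 1 ≤ k → ‖v‖ ≤ D * (‖u ^ k‖ * C ^ k)) : v = 0 := by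
  have ht := ((h.summable hC).tendsto_atTop_zero).const_mul D
  rw [mul_zero] at ht
  have := ge_of_tendsto ht (Filter.eventually_atTop.2 ⟨1, hb⟩)
  exact norm_le_zero_iff.1 this

theorem qn_mul_compl {S X : A} {n : ℕ} (hc : X * S = S * X) (hX : X * S * X = X)
    (hq : QN (S ^ n - S * X)) : QN (S * (1 - S * X)) := by
  have hE : S * X * (S * X) = S * X := by rw [mul_assoc, ← mul_assoc X, hX]
  have hSE : Commute S (S * X) := by
    change S * (S * X) = S * X * S
    rw [mul_assoc, hc]
  have hSP : Commute S (1 - S * X) := (Commute.one_right _).sub_right hSE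
  have hP : (1 - S * X) * (1 - S * X) = 1 - S * X := by
    simp only [mul_sub, sub_mul, hE]; simp
  by_cases hn : n = 0
  · subst hn
    have hSS : QN ((1 : A) - S * X) := by simpa using hq
    have : (1 : A) - S * X = 0 := by
      apply hSS.eq_zero_of_bound (C := 1 / 2) (D := ‖(1 : A) - S * X‖ * 0 + 0) (by norm_num)
      intro k hk
      have h1 := hSS 1 one_ne_zero
      have h2 : S * X * (1 - S * X) = 0 := by rw [mul_sub, hE]; simp
      have h3 : (1 : A) - S * X = 0 := by
        have h4 : IsUnit (S * X) := by simpa using h1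
        exact (IsUnit.mul_right_eq_zero h4).1 h2
      simp [h3]
    rw [this, mul_zero]; exact qn_zero
  · apply QN.of_pow (n := n)
    have : (S * (1 - S * X)) ^ n = (S ^ n - S * X) * (1 - S * X) := by
      rw [hSP.mul_pow, sub_mul, mul_sub (S * X), hE, mul_one, sub_self, sub_zero]
      rw [(show IsIdempotentElem (1 - S * X) from hP).pow_eq hn]
    rw [this]
    apply hq.mul_idem hP
    exact (hSP.pow_left n).sub_left ((Commute.one_right _).sub_right (Commute.refl _))

theorem double_comm {S X : A} {n : ℕ} (hc : X * S = S * X) (hX : X * S * X = X)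
    (hq : QN (S ^ n - S * X)) : ∀ z : A, z * S = S * z → X * z = z * X := by
  intro z hz
  have hu := qn_mul_compl hc hX hq
  have hE : S * X * (S * X) = S * X := by rw [mul_assoc, ← mul_assoc X, hX]
  have hcSX : Commute S X := hc.symm
  have hSE : Commute S (S * X) := (Commute.refl S).mul_right hcSX
  have hSP : Commute S (1 - S * X) := (Commute.one_right _).sub_right hSE
  have hP : (1 - S * X) * (1 - S * X) = 1 - S * X := by
    simp only [mul_sub, sub_mul, hE]; simp
  have hzS : Commute z S := hz
  have hpw : ∀ k : ℕ, 1 ≤ k → (S * (1 - S * X)) ^ k = S ^ k * (1 - S * X) := by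
    intro k hk
    rw [hSP.mul_pow, (show IsIdempotentElem (1 - S * X) from hP).pow_eq (by omega)]
  have hEk : ∀ k : ℕ, 1 ≤ k → S * X = S ^ k * X ^ k := by
    intro k hk
    rw [← hcSX.mul_pow, (show IsIdempotentElem (S * X) from hE).pow_eq (by omega)]
  have h1 : (1 - S * X) * z * (S * X) = 0 := by
    apply hu.eq_zero_of_bound (C := ‖X‖) (D := ‖z‖) (norm_nonneg _)
    intro k hk
    have : (1 - S * X) * z * (S * X) = (S * (1 - S * X)) ^ k * z * X ^ k := by
      rw [hpw k hk, (hSP.pow_left k).eq]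
      have hz' : z * (S * X) = z * (S ^ k * X ^ k) := by rw [← hEk k hk]
      conv_lhs => rw [mul_assoc, hz']
      conv_rhs => rw [mul_assoc (1 - S * X), ← (hzS.pow_right k).eq]
      simp only [mul_assoc]
    rw [this]
    refine (norm_pow_le_mul _ _ _).trans ?_
    rw [← mul_assoc, mul_comm ‖z‖]
    gcongr
    exact norm_mul_le _ _
  have h2 : S * X * z * (1 - S * X) = 0 := by
    apply hu.eq_zero_of_bound (C := ‖X‖) (D := ‖z‖) (norm_nonneg _)
    intro k hk
    have : S * X * z * (1 - S * X) = X ^ k * (z * (S * (1 - S * X)) ^ k) := by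
      rw [hpw k hk, ← mul_assoc z, (hzS.pow_right k).eq]
      have hz' : S * X * (z * (1 - S * X)) = X ^ k * S ^ k * (z * (1 - S * X)) := by
        rw [← (hcSX.pow_pow k k).eq, ← hEk k hk]
      conv_lhs => rw [mul_assoc, hz']
      simp only [mul_assoc]
    rw [this]
    refine (norm_pow_le_mul' _ _ _).trans ?_
    rw [mul_comm]
    rw [← mul_assoc]
    gcongr
    exact norm_mul_le _ _
  have h3 : z * (S * X) = S * X * z := by
    have e1 : z * (S * X) = S * X * z * (S * X) := by
      have := h1
      rw [sub_mul, sub_mul, one_mul, sub_eq_zero] at this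
      exact this
    have e2 : S * X * z = S * X * z * (S * X) := by
      have := h2
      rw [mul_sub, mul_one, sub_eq_zero] at this
      exact this
    rw [e1, ← e2]
  calc X * z = X * (S * X * z) := by rw [← mul_assoc, ← mul_assoc, hX]
    _ = X * (z * (S * X)) := by rw [h3]
    _ = X * (z * S) * X := by simp only [mul_assoc]
    _ = X * S * z * X := by rw [hz]; simp only [mul_assoc]
    _ = S * X * z * X := by rw [hc]
    _ = z * (S * X) * X := by rw [h3]
    _ = z * (X * S * X) := by rw [hc]; simp only [mul_assoc]
    _ = z * X := by rw [hX]

/-- Solution of the Sylvester type equation `w = y c + y w d`. -/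
theorem exists_sylvester {d : A} (hd : QN d) (y c : A) : ∃ w : A, w = y * c + y * w * d := by
  have hs : Summable (fun k : ℕ => y ^ k * (y * c * d ^ k)) := by
    refine Summable.of_norm_bounded (g := fun k => ‖y * c‖ * (‖d ^ k‖ * ‖y‖ ^ k))
      ((hd.summable (norm_nonneg y)).mul_left _) ?_
    intro k
    refine (norm_pow_le_mul' _ _ _).trans ?_
    rw [mul_comm, ← mul_assoc]
    gcongr
    exact norm_mul_le _ _
  refine ⟨∑' k : ℕ, y ^ k * (y * c * d ^ k), ?_⟩
  rw [← hs.tsum_mul_left, ← (hs.mul_left y).tsum_mul_right]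
  conv_lhs => rw [hs.tsum_eq_zero_add]
  simp only [pow_zero, one_mul, mul_one]
  congr 2
  funext k
  rw [pow_succ', pow_succ]
  simp only [mul_assoc]

theorem rassoc {u v w : A} (h : u * v = w) (t : A) : u * (v * t) = w * t := by
  rw [← mul_assoc, h]

theorem isGnsDrazinInvertible_add₂ (n : ℕ) (hn : 1 ≤ n) (a b x y : A)
    (hx : (∀ z : A, z * a = a * z → x * z = z * x) ∧ x * a * x = x ∧
      IsQuasinilpotent (a ^ n - a * x))
    (hy : (∀ z : A, z * b = b * z → y * z = z * y) ∧ y * b * y = y ∧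
      IsQuasinilpotent (b ^ n - b * y))
    (h1 : a = a * (1 - b * y))
    (h2 : b = b * (1 - a * x))
    (h3 : (1 - b * y) * a * b * (1 - a * x) = 0) :
    IsGnsDrazinInvertible n (a + b) := by
  obtain ⟨hx1, hx2, hx3⟩ := hx
  obtain ⟨hy1, hy2, hy3⟩ := hy
  have hnt : Nontrivial A := by
    by_contra hc
    have := not_nontrivial_iff_subsingleton.1 hc
    rw [IsQuasinilpotent, spectrum.of_subsingleton] at hx3
    exact Set.singleton_ne_empty _ hx3.symm
  have hxa : x * a = a * x := hx1 a rfl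
  have hyb : y * b = b * y := hy1 b rfl
  have qa := qn_mul_compl hxa hx2 hx3.qn
  have qb := qn_mul_compl hyb hy2 hy3.qn
  have qa' := hx3.qn
  have qb' := hy3.qn
  obtain ⟨p, hp⟩ : ∃ p, a * x = p := ⟨_, rfl⟩
  obtain ⟨q, hq⟩ : ∃ q, b * y = q := ⟨_, rfl⟩
  rw [hp] at hxa
  rw [hq] at hyb
  rw [hp] at h2 h3 qa qa'
  rw [hq] at h1 h3 qb qb'
  rw [mul_assoc, hp] at hx2
  rw [mul_assoc, hq] at hy2
  have hpx : p * x = x := by rw [← hxa, mul_assoc, hp, hx2]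
  have hqy : q * y = y := by rw [← hyb, mul_assoc, hq, hy2]
  have hpp : p * p = p := by nth_rw 1 [← hp]; rw [mul_assoc, hx2, hp]
  have hqq : q * q = q := by nth_rw 1 [← hq]; rw [mul_assoc, hy2, hq]
  have hap : a * p = p * a := by rw [← hp, mul_assoc, hxa, hp]
  have hbq : b * q = q * b := by rw [← hq, mul_assoc, hyb, hq]
  have haq : a * q = 0 := by
    rw [mul_sub, mul_one] at h1
    exact sub_eq_self.1 h1.symm
  have hbp : b * p = 0 := by
    rw [mul_sub, mul_one] at h2
    exact sub_eq_self.1 h2.symm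
  have hpq : p * q = 0 := by rw [← hxa, mul_assoc, haq, mul_zero]
  have hqp : q * p = 0 := by rw [← hyb, mul_assoc, hbp, mul_zero]
  have hqab : q * (a * b) = a * b := by
    rw [mul_assoc, ← h2, sub_mul, sub_mul, one_mul, sub_eq_zero] at h3
    rw [← mul_assoc, ← h3]
  have hxq : x * q = 0 := by rw [← hx2, mul_assoc, hpq, mul_zero]
  have hyp : y * p = 0 := by rw [← hy2, mul_assoc, hqp, mul_zero]
  have hpb : p * b = 0 := by rw [← hxa, mul_assoc, ← hqab, ← mul_assoc, hxq, zero_mul]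
  have hxb : x * b = 0 := by rw [← hx2, mul_assoc, hpb, mul_zero]
  have hay : a * y = 0 := by rw [← hqy, ← mul_assoc, haq, zero_mul]
  have hbx : b * x = 0 := by rw [← hpx, ← mul_assoc, hbp, zero_mul]
  have hxy : x * y = 0 := by rw [← hqy, ← mul_assoc, hxq, zero_mul]
  have hyx : y * x = 0 := by rw [← hpx, ← mul_assoc, hyp, zero_mul]
  have hpy : p * y = 0 := by rw [← hqy, ← mul_assoc, hpq, zero_mul]
  have hqx : q * x = 0 := by rw [← hpx, ← mul_assoc, hqp, zero_mul]
  -- the quasinilpotent corner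
  have qra : QN ((1 - p - q) * a) := by
    have e : (1 - p - q) * a = a * (1 - p) + -(q * a) := by
      rw [mul_sub, hap]; noncomm_ring
    rw [e]
    apply qa.add
    · apply qn_of_sq
      simp only [neg_mul_neg, mul_assoc, rassoc haq, zero_mul, mul_zero]
    · simp only [mul_neg, neg_zero, sub_mul, mul_sub, mul_assoc, rassoc hpq, rassoc haq, hap,
        one_mul, zero_mul, mul_zero, sub_zero]
  have qrb : QN ((1 - p - q) * b) := by
    have e : (1 - p - q) * b = b * (1 - q) := by
      rw [mul_sub, hbq, sub_mul, sub_mul, hpb]; noncomm_ring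
    rw [e]; exact qb
  have qd : QN ((1 - p - q) * (a + b)) := by
    rw [mul_add]
    apply qra.add qrb
    have hpab : p * (a * b) = 0 := by rw [← hqab, rassoc hpq, zero_mul]
    have harb : a * ((1 - p - q) * b) = a * b := by
      simp only [sub_mul, mul_sub, one_mul, hpb, rassoc haq, mul_zero, zero_mul, sub_zero]
    rw [mul_assoc, harb, sub_mul, sub_mul, hpab, hqab]; simp
  obtain ⟨w, hw⟩ := exists_sylvester qd y a
  have hqw : q * w = w := by
    rw [hw]; simp only [mul_add, mul_assoc, rassoc hqy]
  have hwp : w * p = 0 := by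
    rw [hw]
    simp only [mul_add, add_mul, mul_sub, sub_mul, one_mul, mul_assoc, hap, hbp, rassoc hyp,
      rassoc hpp, rassoc hqp, mul_zero, zero_mul, add_zero, sub_zero, sub_self]
  have hwq : w * q = 0 := by
    rw [hw]
    simp only [mul_add, add_mul, mul_sub, sub_mul, one_mul, mul_assoc, haq, hbq, rassoc hyp,
      rassoc hpq, rassoc hqq, mul_zero, zero_mul, add_zero, sub_zero, sub_self]
  have hwr : w * ((1 - p - q) * (a + b)) = w * a + w * b := by
    simp only [mul_sub, sub_mul, one_mul, rassoc hwp, rassoc hwq, zero_mul, sub_zero, mul_add]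
  have hwx : w * x = 0 := by rw [← hpx, rassoc hwp, zero_mul]
  have hwy : w * y = 0 := by rw [← hqy, rassoc hwq, zero_mul]
  have hpw : p * w = 0 := by rw [← hqw, rassoc hpq, zero_mul]
  have hxw : x * w = 0 := by rw [← hqw, rassoc hxq, zero_mul]
  have haw : a * w = 0 := by rw [← hqw, rassoc haq, zero_mul]
  have hww : w * w = 0 := by nth_rw 2 [← hqw]; rw [rassoc hwq, zero_mul]
  rw [mul_assoc, hwr] at hw
  have hya : y * a + (y * (w * a) + y * (w * b)) = w := by
    rw [← mul_add]; exact hw.symm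
  have hbw : b * w = q * a + (w * a + w * b) := by
    conv_lhs => rw [hw]
    rw [mul_add, rassoc hq, rassoc hq, mul_add q, rassoc hqw, rassoc hqw]
  have hSX : (a + b) * (x + y + y * w) = p + q + w := by
    simp only [mul_add, add_mul, hp, hay, hbx, hq, rassoc hay, rassoc hq, hqw, zero_mul]
    abel
  have hXS : (x + y + y * w) * (a + b) = p + q + w := by
    have e : (x + y + y * w) * (a + b)
        = p + q + (y * a + (y * (w * a) + y * (w * b))) := by
      simp only [mul_add, add_mul, hxa, hxb, hyb, mul_assoc]
      abel
    rw [e, hya]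
  have hXSX : (x + y + y * w) * (a + b) * (x + y + y * w) = x + y + y * w := by
    rw [hXS]
    simp only [mul_add, add_mul, hpx, hpy, hqx, hqy, hwx, hwy, rassoc hpy, rassoc hqy, rassoc hwy,
      zero_mul, add_zero, zero_add]
  -- splitting of `S ^ n - S X`
  have hSp : Commute (a + b) p := by
    change (a + b) * p = p * (a + b)
    rw [add_mul, mul_add, hap, hbp, hpb]
  have hSE : Commute (a + b) (p + q + w) := by
    change (a + b) * _ = _ * (a + b)
    simp only [mul_add, add_mul, hap, hbp, hpb, haq, hbq, haw, hbw]
    abel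
  have hSg : Commute (a + b) (q + w) := by
    have := hSE.sub_right hSp
    rwa [show p + q + w - p = q + w by abel] at this
  have hEE : (p + q + w) * (p + q + w) = p + q + w := by
    simp only [mul_add, add_mul, hpp, hqq, hpq, hqp, hpw, hqw, hwp, hwq, hww, add_zero, zero_add]
  have hFF : IsIdempotentElem (1 - (p + q + w)) := by
    exact (show IsIdempotentElem (p + q + w) from hEE).one_sub
  have hSnp : ∀ k : ℕ, (a + b) ^ k * p = a ^ k * p := by
    intro k
    induction k with
    | zero => simp
    | succ k ih =>
      rw [pow_succ, pow_succ, mul_assoc, mul_assoc, add_mul, hbp, add_zero, hap, ← mul_assoc, ih,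
        mul_assoc]
  have hSnq : ∀ k : ℕ, (a + b) ^ k * q = b ^ k * q := by
    intro k
    induction k with
    | zero => simp
    | succ k ih =>
      rw [pow_succ, pow_succ, mul_assoc, mul_assoc, add_mul, haq, zero_add, hbq, ← mul_assoc, ih,
        mul_assoc]
  have q1 : QN ((a ^ n - p) * p) := by
    apply qa'.mul_idem hpp
    exact ((show Commute a p from hap).pow_left n).sub_left (Commute.refl p)
  have q2 : QN ((b ^ n - q) * q) := by
    apply qb'.mul_idem hqq
    exact ((show Commute b q from hbq).pow_left n).sub_left (Commute.refl q)
  have q3 : QN ((b ^ n - q) * q * (q + w)) := by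
    have e : (b ^ n - q) * q * (q + w) = (b ^ n - q) * w + (b ^ n - q) * q := by
      rw [mul_assoc, mul_add, hqq, hqw, mul_add, add_comm]
    have hc : Commute (b ^ n - q) q :=
      ((show Commute b q from hbq).pow_left n).sub_left (Commute.refl q)
    have hz : w * ((b ^ n - q) * q) = 0 := by rw [hc.eq, rassoc hwq, zero_mul]
    rw [e]
    refine QN.add (qn_of_sq ?_) q2 ?_
    · nth_rw 2 [← hqw]
      rw [mul_assoc, ← mul_assoc (b ^ n - q) q w, ← mul_assoc w, hz, zero_mul, mul_zero]
    · rw [mul_assoc, hz, mul_zero]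
  have q4 : QN (((a + b) * (1 - (p + q + w))) ^ n) := by
    apply QN.pow _ hn
    have hrw : (1 - p - q) * w = 0 := by
      rw [sub_mul, sub_mul, hpw, hqw, one_mul, sub_zero, sub_self]
    have e : (a + b) * (1 - (p + q + w))
        = (1 - p - q) * (a + b) + -(w * ((1 - p - q) * (a + b))) := by
      rw [hwr, mul_sub, hSE.eq]
      noncomm_ring
    have hdw : (1 - p - q) * (a + b) * w = 0 := by
      rw [mul_assoc, add_mul, haw, hbw, zero_add, ← mul_add, mul_add, ← mul_assoc _ w, hrw,
        sub_mul, sub_mul, rassoc hpq, rassoc hqq]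
      simp
    rw [e]
    refine qd.add (qn_of_sq ?_) ?_
    · rw [neg_mul_neg, mul_assoc, ← mul_assoc _ w, hdw, zero_mul, mul_zero]
    · rw [mul_neg, ← mul_assoc _ w, hdw, zero_mul, neg_zero]
  have hfin : QN ((a + b) ^ n - (a + b) * (x + y + y * w)) := by
    have hSF : Commute (a + b) (1 - (p + q + w)) := (Commute.one_right _).sub_right hSE
    have e1 : (a ^ n - p) * p = ((a + b) ^ n - 1) * p := by
      rw [sub_mul, sub_mul, hpp, hSnp, one_mul]
    have e2 : (b ^ n - q) * q * (q + w) = ((a + b) ^ n - 1) * (q + w) := by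
      have : ((a + b) ^ n - 1) * q = (b ^ n - q) * q := by
        rw [sub_mul, sub_mul, hqq, hSnq, one_mul]
      rw [← this, mul_assoc, mul_add, hqq, hqw]
    have e3 : ((a + b) * (1 - (p + q + w))) ^ n = (a + b) ^ n * (1 - (p + q + w)) := by
      rw [hSF.mul_pow, hFF.pow_eq (by omega)]
    rw [e1] at q1
    rw [e2] at q3
    rw [e3] at q4
    have e : (a + b) ^ n - (a + b) * (x + y + y * w) = ((a + b) ^ n - 1) * p
        + ((a + b) ^ n - 1) * (q + w) + (a + b) ^ n * (1 - (p + q + w)) := by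
      rw [hSX]; noncomm_ring
    rw [e]
    have c1 : Commute ((a + b) ^ n - 1) (q + w) :=
      (hSg.pow_left n).sub_left (Commute.one_left _)
    have c2 : Commute ((a + b) ^ n) (1 - (p + q + w)) := hSF.pow_left n
    refine (q1.add q3 ?_).add q4 ?_
    · rw [c1.eq, mul_assoc, rassoc (show p * (q + w) = 0 by rw [mul_add, hpq, hpw, add_zero])]
      simp
    · rw [← mul_add, c2.eq, mul_assoc, ← add_assoc]
      rw [rassoc (show (p + q + w) * (1 - (p + q + w)) = 0 by rw [mul_sub, hEE]; simp)]
      simp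
  exact ⟨x + y + y * w, double_comm (hXS.trans hSX.symm) hXSX hfin, hXSX,
    hfin.isQuasinilpotent⟩
end
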